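/- arXiv:1212.0718 — 8 statements merged into one kernel-verified Lean document; each statement's English description precedes it below -/
import Mathlib

section
/- Let K be a field of characteristic zero and let n ≥ 1, m ≥ 1 and k ∈ {0,1,2} be integers. Then there exists a nonzero polynomial G in 4n variables over K such that for every tuple (v_1,…,v_n) of nonzero vectors in K^4 with G(v_1,…,v_n) ≠ 0, the ideal I = ⋂_{j=1}^n m_{v_j} of the corresponding simple points in P^3 satisfies the generalized Chudnovsky bound α(I^{(3m-k)}) ≥ m·α(I) + 2m − k. -/
open MvPolynomial Filter

noncomputable section

/-- The ideal of a point of `ℙ³` represented by a nonzero vector `v ∈ K⁴`: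
the ideal generated by all linear forms vanishing at `v`. -/
def pointIdeal (K : Type) [Field K] (v : Fin 4 → K) : Ideal (MvPolynomial (Fin 4) K) :=
  Ideal.span {f | f.IsHomogeneous 1 ∧ eval v f = 0}

/-- `α(J)`: the least `t ≥ 0` such that the degree-`t` homogeneous component of the
homogeneous ideal `J` is nonzero. -/
def alphaDeg {K : Type} [Field K] {σ : Type} (J : Ideal (MvPolynomial σ K)) : ℕ :=
  sInf {t | ∃ f ∈ J, f ≠ 0 ∧ f.IsHomogeneous t}

section LineEval

variable {K σ : Type} [Field K]

/-- Restriction of a polynomial to the parametrized line `p + t w`, with parameter `t`. -/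
def lineEval (p w : σ → K) : MvPolynomial σ K →ₐ[K] Polynomial K :=
  aeval fun i => Polynomial.C (p i) + Polynomial.X * Polynomial.C (w i)

/-- `F` vanishes to order at least `M` at `p`, tested on lines through `p`. -/
def VanishesToOrder (F : MvPolynomial σ K) (M : ℕ) (p : σ → K) : Prop :=
  ∀ w, Polynomial.X ^ M ∣ lineEval p w F

lemma coeff_zero_lineEval (p w : σ → K) (F : MvPolynomial σ K) :
    (lineEval p w F).coeff 0 = eval p F := by
  rw [Polynomial.coeff_zero_eq_eval_zero]
  induction F using MvPolynomial.induction_on with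
  | C a => simp [lineEval]
  | add f g hf hg => simp [hf, hg]
  | mul_X f i hf => simp [hf]; simp [lineEval]

lemma X_pow_dvd_lineEval_of_forall_ne_zero [Infinite K] (F : MvPolynomial σ K) (M : ℕ)
    (p q w w' : σ → K)
    (h : ∀ z : K, z ≠ 0 → Polynomial.X ^ M ∣ lineEval (p + z • q) (w + z • w') F) :
    Polynomial.X ^ M ∣ lineEval p w F := by
  obtain ⟨P, hP⟩ : ∃ P : Polynomial (Polynomial K), ∀ z : K,
      P.map (Polynomial.evalRingHom z) = lineEval (p + z • q) (w + z • w') F := by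
    refine ⟨aeval (fun i => Polynomial.C (Polynomial.C (p i) + Polynomial.X * Polynomial.C (q i)) +
      Polynomial.X * Polynomial.C (Polynomial.C (w i) + Polynomial.X * Polynomial.C (w' i))) F,
      fun z => ?_⟩
    clear h
    induction F using MvPolynomial.induction_on with
    | C c => simp [lineEval]
    | add f g hf hg => rw [map_add, map_add, Polynomial.map_add, hf, hg]
    | mul_X f i hf =>
      rw [map_mul, map_mul, Polynomial.map_mul, hf]
      congr 1
      simp only [lineEval, aeval_X]
      simp only [Polynomial.map_add, Polynomial.map_mul, Polynomial.map_C, Polynomial.map_X]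
      simp [mul_comm z]
  rw [Polynomial.X_pow_dvd_iff]
  intro d hd
  have hz : ∀ z : K, z ≠ 0 → (P.coeff d).IsRoot z := fun z hz => by
    have := Polynomial.X_pow_dvd_iff.1 (h z hz) d hd
    rwa [← hP, Polynomial.coeff_map] at this
  have h0 : P.coeff d = 0 :=
    Polynomial.eq_zero_of_infinite_isRoot _
      ((Set.finite_singleton (0 : K)).infinite_compl.mono fun z h => hz z h)
  have := hP 0
  simp only [zero_smul, add_zero] at this
  rw [← this, Polynomial.coeff_map, h0, map_zero]

end LineEval

section LinearForms

variable {K σ : Type} [Field K] [Fintype σ]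

/-- The linear form with coefficient vector `a`. -/
def linForm (a : σ → K) : MvPolynomial σ K := ∑ i, C (a i) * X i

/-- Substitution by the linear projection `p ↦ p - (a ⬝ᵥ p) • u`; when `a ⬝ᵥ u = 1` its image is
the hyperplane `a ⬝ᵥ p = 0`. -/
def projHom (a u : σ → K) : MvPolynomial σ K →ₐ[K] MvPolynomial σ K :=
  aeval fun i => X i - linForm a * C (u i)

lemma eval_linForm (a p : σ → K) : eval p (linForm a) = a ⬝ᵥ p := by
  simp [linForm, dotProduct]

lemma linForm_sub_smul (a b : σ → K) (c : K) :
    linForm (b - c • a) = linForm b - linForm a * C c := by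
  simp only [linForm, Pi.sub_apply, Pi.smul_apply, smul_eq_mul, map_sub, map_mul, sub_mul,
    Finset.sum_sub_distrib, Finset.sum_mul]
  refine congrArg (_ - ·) (Finset.sum_congr rfl fun i _ => ?_)
  ring

lemma linForm_isHomogeneous (a : σ → K) : (linForm a).IsHomogeneous 1 := by
  rw [linForm]
  exact IsHomogeneous.sum _ (fun i => C (a i) * X i) 1 fun i _ => isHomogeneous_C_mul_X (a i) i

lemma linForm_ne_zero {a : σ → K} {p : σ → K} (h : a ⬝ᵥ p ≠ 0) : linForm a ≠ 0 := fun h0 => by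
  rw [← eval_linForm, h0, map_zero] at h
  exact h rfl

lemma projHom_linForm (a u b : σ → K) :
    projHom a u (linForm b) = linForm (b - (b ⬝ᵥ u) • a) := by
  rw [linForm_sub_smul]
  simp only [projHom, linForm, map_sum, map_mul, aeval_X, algHom_C, algebraMap_eq, mul_sub,
    Finset.sum_sub_distrib, dotProduct]
  congr 1
  rw [Finset.mul_sum]
  exact Finset.sum_congr rfl fun i _ => by ring

lemma lineEval_linForm (p w a : σ → K) :
    lineEval p w (linForm a) =
      Polynomial.C (a ⬝ᵥ p) + Polynomial.X * Polynomial.C (a ⬝ᵥ w) := by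
  simp only [lineEval, linForm, map_sum, map_mul, aeval_X, algHom_C, dotProduct, mul_add,
    Finset.sum_add_distrib, Finset.mul_sum, Polynomial.algebraMap_eq]
  congr 1
  exact Finset.sum_congr rfl fun i _ => by ring

lemma lineEval_projHom (a u p w : σ → K) (F : MvPolynomial σ K) :
    lineEval p w (projHom a u F) =
      lineEval (p - (a ⬝ᵥ p) • u) (w - (a ⬝ᵥ w) • u) F := by
  induction F using MvPolynomial.induction_on with
  | C c => simp [lineEval, projHom]
  | add f g hf hg => simp [hf, hg]
  | mul_X f i hf =>
    rw [map_mul, map_mul, map_mul, hf]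
    congr 1
    simp only [projHom, aeval_X, map_sub, map_mul, lineEval_linForm]
    simp [lineEval]
    ring

lemma eval_projHom (a u p : σ → K) (F : MvPolynomial σ K) :
    eval p (projHom a u F) = eval (p - (a ⬝ᵥ p) • u) F := by
  rw [← coeff_zero_lineEval p 0, lineEval_projHom, coeff_zero_lineEval]

lemma totalDegree_projHom_le (a u : σ → K) (F : MvPolynomial σ K) :
    (projHom a u F).totalDegree ≤ F.totalDegree := by
  rw [projHom, aeval_def, eval₂_eq]
  refine totalDegree_finsetSum_le fun d hd => (totalDegree_mul _ _).trans ?_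
  rw [algebraMap_eq, totalDegree_C, zero_add]
  refine (totalDegree_finsetProd _ _).trans (le_trans ?_ (le_totalDegree hd))
  refine Finset.sum_le_sum fun i _ => (totalDegree_pow _ _).trans ?_
  refine mul_le_of_le_one_right (Nat.zero_le _) (IsHomogeneous.totalDegree_le ?_)
  refine (isHomogeneous_X K i).sub ?_
  simpa using (linForm_isHomogeneous a).mul (isHomogeneous_C σ (u i))

lemma linForm_dvd_sub_projHom (a u : σ → K) (F : MvPolynomial σ K) :
    linForm a ∣ F - projHom a u F := by
  induction F using MvPolynomial.induction_on with
  | C c => simp [projHom]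
  | add f g hf hg => rw [map_add, add_sub_add_comm]; exact dvd_add hf hg
  | mul_X f i hf =>
    have : f * X i - projHom a u (f * X i) =
        (f - projHom a u f) * X i + linForm a * (C (u i) * projHom a u f) := by
      rw [map_mul, projHom, aeval_X]
      ring
    rw [this]
    exact dvd_add (hf.mul_right _) (dvd_mul_right _ _)

lemma linForm_dvd_iff {a u : σ → K} (h : a ⬝ᵥ u = 1) (F : MvPolynomial σ K) :
    linForm a ∣ F ↔ projHom a u F = 0 := by
  refine ⟨?_, fun hF => by simpa [hF] using linForm_dvd_sub_projHom a u F⟩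
  rintro ⟨G, rfl⟩
  rw [map_mul, projHom_linForm, h, one_smul, sub_self]
  simp [linForm]

lemma linForm_prime {a u : σ → K} (h : a ⬝ᵥ u = 1) : Prime (linForm a) := by
  refine ⟨linForm_ne_zero (p := u) (by simp [h]), fun hu => ?_, fun F G hFG => ?_⟩
  · have := (linForm_dvd_iff h 1).1 hu.dvd
    simp at this
  · simpa only [linForm_dvd_iff h, map_mul, mul_eq_zero] using hFG

end LinearForms

section StarConfiguration

variable {K σ ι : Type} [Field K] [Fintype σ]

lemma exists_dotProduct_eq_one {a q : σ → K} (h : a ⬝ᵥ q ≠ 0) : ∃ u, a ⬝ᵥ u = 1 :=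
  ⟨(a ⬝ᵥ q)⁻¹ • q, by rw [dotProduct_smul, smul_eq_mul, inv_mul_cancel₀ h]⟩

/-- Removing a linear factor that vanishes on a linear subspace `W` lowers the order of vanishing
along `W` by at most one. -/
lemma VanishesToOrder.of_linForm_mul [Infinite K] {a q : σ → K} (hq : a ⬝ᵥ q ≠ 0)
    {W : Submodule K (σ → K)} (ha : ∀ p ∈ W, a ⬝ᵥ p = 0) {F : MvPolynomial σ K} {M : ℕ}
    (hF : ∀ p ∈ W, VanishesToOrder (linForm a * F) (M + 1) p) :
    ∀ p ∈ W, VanishesToOrder F M p := by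
  have key : ∀ p ∈ W, ∀ w, a ⬝ᵥ w ≠ 0 → Polynomial.X ^ M ∣ lineEval p w F := by
    intro p hp w hw
    have h := hF p hp w
    rw [map_mul, lineEval_linForm, ha p hp, map_zero, zero_add, pow_succ', mul_assoc,
      mul_dvd_mul_iff_left Polynomial.X_ne_zero] at h
    exact (IsUnit.dvd_mul_left (Polynomial.isUnit_C.2 (isUnit_iff_ne_zero.2 hw))).1 h
  intro p hp w
  by_cases hw : a ⬝ᵥ w = 0
  · refine X_pow_dvd_lineEval_of_forall_ne_zero F M p 0 w q fun z hz => ?_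
    rw [smul_zero, add_zero]
    refine key p hp _ ?_
    rw [dotProduct_add, hw, zero_add, dotProduct_smul]
    exact mul_ne_zero hz hq
  · exact key p hp w hw

/-- Removing a linear factor that does not vanish identically on a linear subspace `W` preserves
the order of vanishing along `W`. -/
lemma VanishesToOrder.of_linForm_mul_of_ne [Infinite K] {a q : σ → K} (hq : a ⬝ᵥ q ≠ 0)
    {W : Submodule K (σ → K)} (hqW : q ∈ W) {F : MvPolynomial σ K} {M : ℕ}
    (hF : ∀ p ∈ W, VanishesToOrder (linForm a * F) M p) :
    ∀ p ∈ W, VanishesToOrder F M p := by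
  have key : ∀ p ∈ W, a ⬝ᵥ p ≠ 0 → ∀ w, Polynomial.X ^ M ∣ lineEval p w F := by
    intro p hp hap w
    have h := hF p hp w
    rw [map_mul] at h
    refine Polynomial.prime_X.pow_dvd_of_dvd_mul_left M ?_ h
    rw [Polynomial.X_dvd_iff, coeff_zero_lineEval, eval_linForm]
    exact hap
  intro p hp w
  by_cases hap : a ⬝ᵥ p = 0
  · refine X_pow_dvd_lineEval_of_forall_ne_zero F M p q w 0 fun z hz => ?_
    refine key _ (W.add_mem hp (W.smul_mem z hqW)) ?_ _
    rw [dotProduct_add, hap, zero_add, dotProduct_smul]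
    exact mul_ne_zero hz hq
  · exact key p hp hap w

/-- The common zero locus of the linear forms `a i`, `i ∈ S`. -/
def linLocus (a : ι → σ → K) (S : Finset ι) : Submodule K (σ → K) where
  carrier := {p | ∀ i ∈ S, a i ⬝ᵥ p = 0}
  add_mem' hp hq i hi := by rw [dotProduct_add, hp i hi, hq i hi, add_zero]
  zero_mem' i _ := dotProduct_zero _
  smul_mem' c p hp i hi := by rw [dotProduct_smul, hp i hi, smul_zero]

lemma mem_linLocus {a : ι → σ → K} {S : Finset ι} {p : σ → K} :
    p ∈ linLocus a S ↔ ∀ i ∈ S, a i ⬝ᵥ p = 0 := Iff.rfl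

/-- The linear forms `a i`, `i ∈ I`, are in general position up to codimension `e`: none of them
vanishes on the common zero locus of at most `e` others. -/
def GeneralForms (a : ι → σ → K) (I : Finset ι) (e : ℕ) : Prop :=
  ∀ S ⊆ I, S.card ≤ e → ∀ i ∈ I, i ∉ S → ∃ q ∈ linLocus a S, a i ⬝ᵥ q ≠ 0

lemma GeneralForms.ne {a : ι → σ → K} {I : Finset ι} {e : ℕ} (h : GeneralForms a I e) {i : ι}
    (hi : i ∈ I) : ∃ q, a i ⬝ᵥ q ≠ 0 := by
  obtain ⟨q, -, hq⟩ := h ∅ (Finset.empty_subset I) (by simp) i hi (by simp)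
  exact ⟨q, hq⟩

lemma VanishesToOrder.of_prod_linForm_mul [Infinite K] [DecidableEq ι] {a : ι → σ → K}
    {I : Finset ι} {e : ℕ} (h : GeneralForms a I e) {S : Finset ι} (hS : S ⊆ I)
    (hSe : S.card ≤ e) (B : Finset ι) (hB : B ⊆ I) : ∀ {F : MvPolynomial σ K} {M : ℕ},
      (∀ p ∈ linLocus a S, VanishesToOrder ((∏ i ∈ B, linForm (a i)) * F) (M + (B ∩ S).card) p) →
      ∀ p ∈ linLocus a S, VanishesToOrder F M p := by
  induction B using Finset.induction_on with
  | empty => simp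
  | insert i B hi ih =>
    intro F M hF
    have hiI := hB (Finset.mem_insert_self i B)
    rw [Finset.prod_insert hi] at hF
    have hBI := (Finset.subset_insert i B).trans hB
    by_cases hiS : i ∈ S
    · rw [Finset.insert_inter_of_mem hiS, Finset.card_insert_of_notMem (by simp [hi])] at hF
      obtain ⟨q, hq⟩ := h.ne hiI
      refine VanishesToOrder.of_linForm_mul (a := a i) (W := linLocus a S) hq
        (fun p hp => hp i hiS) (ih hBI ?_)
      intro p hp
      have := hF p hp
      rwa [mul_assoc, mul_left_comm, ← add_assoc, add_right_comm] at this
    · rw [Finset.insert_inter_of_notMem hiS] at hF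
      obtain ⟨q, hqS, hq⟩ := h S hS hSe i hiI hiS
      refine VanishesToOrder.of_linForm_mul_of_ne (a := a i) hq hqS (ih hBI ?_)
      intro p hp
      have := hF p hp
      rwa [mul_assoc, mul_left_comm] at this

lemma prod_linForm_dvd {a : ι → σ → K} {I : Finset ι} {e : ℕ} (he : 0 < e)
    (h : GeneralForms a I e) {F : MvPolynomial σ K} (hF : ∀ i ∈ I, linForm (a i) ∣ F) :
    ∏ i ∈ I, linForm (a i) ∣ F := by
  refine Finset.prod_dvd_of_isRelPrime (fun i hi j hj hij => ?_) hF
  obtain ⟨q, hq⟩ := h.ne hi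
  obtain ⟨u, hu⟩ := exists_dotProduct_eq_one hq
  refine (linForm_prime hu).irreducible.isRelPrime_iff_not_dvd.2 ?_
  rintro ⟨G, hG : linForm (a j) = _⟩
  obtain ⟨r, hr, hjr⟩ := h {i} (by simpa using hi) (by simpa using Nat.one_le_of_lt he) j hj
    (by simpa using hij.symm)
  apply hjr
  rw [← eval_linForm, hG, map_mul, eval_linForm, hr i (by simp), zero_mul]

lemma totalDegree_prod_linForm_mul {a : ι → σ → K} {I : Finset ι} {e : ℕ}
    (h : GeneralForms a I e) {F : MvPolynomial σ K} (hF : F ≠ 0) :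
    ((∏ i ∈ I, linForm (a i)) * F).totalDegree = I.card + F.totalDegree := by
  have h1 : (∏ i ∈ I, linForm (a i)).IsHomogeneous (∑ _i ∈ I, 1) :=
    IsHomogeneous.prod I _ _ fun i _ => linForm_isHomogeneous (a i)
  have h2 : ∏ i ∈ I, linForm (a i) ≠ 0 := Finset.prod_ne_zero_iff.2 fun i hi => by
    obtain ⟨q, hq⟩ := h.ne hi
    exact linForm_ne_zero hq
  rw [totalDegree_mul_of_isDomain h2 hF, h1.totalDegree h2, Finset.card_eq_sum_ones]

/-- Restricting general linear forms to the hyperplane defined by one of them. -/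
lemma GeneralForms.restrict [DecidableEq ι] {a : ι → σ → K} {I : Finset ι} {e : ℕ}
    (h : GeneralForms a I (e + 1)) {i : ι} (hi : i ∈ I) (u : σ → K) :
    GeneralForms (fun j => a j - (a j ⬝ᵥ u) • a i) (I.erase i) e := by
  intro S hS hSe j hj hjS
  have hji := Finset.ne_of_mem_erase hj
  obtain ⟨q, hq, hjq⟩ := h (insert i S)
    (Finset.insert_subset hi (hS.trans (Finset.erase_subset i I)))
    ((Finset.card_insert_le i S).trans (by lia)) j (Finset.mem_of_mem_erase hj)
    (by simp [hji, hjS])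
  have hiq : a i ⬝ᵥ q = 0 := hq i (Finset.mem_insert_self i S)
  refine ⟨q, fun l hl => ?_, ?_⟩
  · simp [sub_dotProduct, hiq, hq l (Finset.mem_insert_of_mem hl)]
  · simpa [sub_dotProduct, hiq] using hjq

lemma VanishesToOrder.projHom_restrict [DecidableEq ι] {a : ι → σ → K} {S : Finset ι}
    {i : ι} {u : σ → K} (hu : a i ⬝ᵥ u = 1) {F : MvPolynomial σ K} {M : ℕ}
    (hF : ∀ p ∈ linLocus a (insert i S), VanishesToOrder F M p) :
    ∀ p ∈ linLocus (fun j => a j - (a j ⬝ᵥ u) • a i) S,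
      VanishesToOrder (projHom (a i) u F) M p := by
  intro p hp w
  rw [lineEval_projHom]
  refine hF _ (mem_linLocus.2 fun l hl => ?_) _
  rcases Finset.mem_insert.1 hl with rfl | hl
  · simp [dotProduct_sub, hu]
  · have := hp l hl
    simp only [sub_dotProduct, smul_dotProduct, smul_eq_mul] at this
    simp only [dotProduct_sub, dotProduct_smul, smul_eq_mul]
    rw [mul_comm, this]

/-- A lower bound for the degree of a polynomial vanishing to given order along a star
configuration: the codimension `e` intersections of hyperplanes in general position. -/
theorem eq_zero_of_vanishesToOrder_star [Infinite K] [DecidableEq ι] (e : ℕ) :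
    ∀ (I : Finset ι) (a : ι → σ → K) (m k : ℕ) (F : MvPolynomial σ K), 0 < e → e ≤ I.card →
      GeneralForms a I e → k < e →
      (∀ S ⊆ I, S.card = e → ∀ p ∈ linLocus a S, VanishesToOrder F (e * m - k) p) →
      F.totalDegree + k < m * I.card → F = 0 := by
  induction e with
  | zero => intro I a m k F he; exact absurd he (lt_irrefl 0)
  | succ e ih =>
    intro I a m k F _ heI h hk hV hdeg
    induction m generalizing F with
    | zero => simp at hdeg
    | succ m ihm =>
      have hdvd : ∀ i ∈ I, linForm (a i) ∣ F := by
        intro i hi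
        obtain ⟨q, hq⟩ := h.ne hi
        obtain ⟨u, hu⟩ := exists_dotProduct_eq_one hq
        rw [linForm_dvd_iff hu]
        rcases Nat.eq_zero_or_pos e with rfl | he
        · refine MvPolynomial.funext fun p => ?_
          rw [map_zero, eval_projHom]
          have := hV {i} (by simpa using hi) (by simp) (p - (a i ⬝ᵥ p) • u)
            (by simp [mem_linLocus, dotProduct_sub, hu]) 0
          rw [← coeff_zero_lineEval _ 0, ← Polynomial.X_dvd_iff]
          exact (dvd_pow_self _ (by lia)).trans this
        · obtain ⟨c, b, hb, hcb⟩ : ∃ c b, b < e ∧ e * c = (e + 1) * (m + 1) - k + b := by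
            set N := (e + 1) * (m + 1) - k
            refine ⟨(N + (e - 1)) / e, (e - 1) - (N + (e - 1)) % e, by lia, ?_⟩
            have := Nat.div_add_mod (N + (e - 1)) e
            have := Nat.mod_lt (N + (e - 1)) he
            lia
          have hcard : (I.erase i).card + 1 = I.card := Finset.card_erase_add_one hi
          refine ih (I.erase i) _ c b _ he (by lia) (h.restrict hi u) hb
            (fun S hS hSe => ?_) (lt_of_le_of_lt
              (Nat.add_le_add_right (totalDegree_projHom_le (a i) u F) b) ?_)
          · rw [show e * c - b = (e + 1) * (m + 1) - k by lia]
            refine VanishesToOrder.projHom_restrict hu (hV _ (Finset.insert_subset hi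
              (hS.trans (Finset.erase_subset i I))) ?_)
            rw [Finset.card_insert_of_notMem (fun hiS => Finset.notMem_erase i I (hS hiS)), hSe]
          · obtain ⟨x, hx⟩ := Nat.exists_eq_add_of_le (show e ≤ (I.erase i).card by lia)
            have hmc : m + 1 ≤ c := by
              by_contra! hc
              have := Nat.mul_le_mul_left e (Nat.le_of_lt_succ hc)
              have : (e + 1) * (m + 1) = e * m + m + e + 1 := by ring
              lia
            have hmx := Nat.mul_le_mul_right x hmc
            rw [← hcard, hx] at hdeg
            rw [hx]
            have h1 : c * (e + x) = e * c + c * x := by ring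
            have h2 : (m + 1) * (e + x + 1) = (e + 1) * (m + 1) + (m + 1) * x := by ring
            have h3 : k ≤ (e + 1) * (m + 1) := hk.le.trans (Nat.le_mul_of_pos_right _ m.succ_pos)
            lia
      obtain ⟨G, rfl⟩ := prod_linForm_dvd (Nat.succ_pos e) h hdvd
      by_contra hne
      have hG : G ≠ 0 := right_ne_zero_of_mul hne
      rw [totalDegree_prod_linForm_mul h hG] at hdeg
      have hm : 0 < m := by
        by_contra hm
        obtain rfl : m = 0 := by lia
        lia
      refine hG (ihm G (fun S hS hSe => ?_) (by lia))
      refine VanishesToOrder.of_prod_linForm_mul h hS hSe.le I subset_rfl ?_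
      rw [Finset.inter_eq_right.2 hS, hSe]
      convert hV S hS hSe using 3
      have : k ≤ (e + 1) * m := hk.le.trans (Nat.le_mul_of_pos_right _ hm)
      lia

end StarConfiguration

section Generic

variable {K : Type} [Field K]

/-- If a linear system depending polynomially on parameters has only the trivial solution for one
value of the parameters, then so it does for all values in a nonempty Zariski open set. -/
lemma exists_ne_zero_of_forall_eq_zero {τ ρ β : Type} [Fintype β] [DecidableEq β]
    (A : ρ → β → MvPolynomial τ K) (v₀ : τ → K)
    (h : ∀ x : β → K, (∀ r, ∑ b, eval v₀ (A r b) * x b = 0) → x = 0) :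
    ∃ G : MvPolynomial τ K, G ≠ 0 ∧ ∀ v, eval v G ≠ 0 →
      ∀ x : β → K, (∀ r, ∑ b, eval v (A r b) * x b = 0) → x = 0 := by
  classical
  let f : ρ → Submodule K (β → K) := fun r =>
    LinearMap.ker (∑ b, eval v₀ (A r b) • (LinearMap.proj b : (β → K) →ₗ[K] K))
  have hf : ∀ r x, x ∈ f r ↔ ∑ b, eval v₀ (A r b) * x b = 0 := fun r x => by simp [f]
  obtain ⟨t, ht⟩ := Finset.exists_inf_le f
  let N (v : τ → K) : Matrix t β K := Matrix.of fun r b => eval v (A r b)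
  have hN : Function.Injective (N v₀).mulVec := by
    rw [← Matrix.coe_mulVecLin, injective_iff_map_eq_zero]
    intro x hx
    refine h x fun r => (hf r x).1 (ht r ?_)
    rw [Submodule.mem_finsetInf]
    intro r hr
    exact (hf r x).2 (congrFun hx ⟨r, hr⟩)
  obtain ⟨B, hB⟩ : ∃ B : Matrix β t K, B * N v₀ = 1 := by
    obtain ⟨g, hg⟩ := LinearMap.exists_leftInverse_of_injective (Matrix.toLin' (N v₀))
      (LinearMap.ker_eq_bot.2 hN)
    refine ⟨LinearMap.toMatrix' g, ?_⟩
    have := congrArg LinearMap.toMatrix' hg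
    rwa [LinearMap.toMatrix'_comp, LinearMap.toMatrix'_toLin', LinearMap.toMatrix'_id] at this
  let A' : Matrix t β (MvPolynomial τ K) := Matrix.of fun r b => A r b
  let B' : Matrix β t (MvPolynomial τ K) := B.map C
  let G := (B' * A').det
  have hG : ∀ v, eval v G = (B * N v).det := fun v => by
    rw [RingHom.map_det]
    congr 1
    ext i j
    simp [Matrix.mul_apply, N, A', B']
  refine ⟨G, fun h0 => ?_, fun v hv x hx => ?_⟩
  · have := hG v₀
    simp [h0, hB] at this
  · rw [hG] at hv
    refine Matrix.eq_zero_of_mulVec_eq_zero hv ?_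
    rw [← Matrix.mulVec_mulVec]
    have : (N v).mulVec x = 0 := funext fun r => hx r
    rw [this, Matrix.mulVec_zero]

lemma exists_eval_eq_lineEval {σ τ : Type} (F : MvPolynomial σ K) (s : σ → τ) (w : σ → K) (c : K)
    (i : ℕ) : ∃ P : MvPolynomial τ K, ∀ v : τ → K,
      eval v P = (lineEval (c • fun l => v (s l)) w F).coeff i := by
  refine ⟨(aeval (fun l => Polynomial.C (C c * X (s l)) + Polynomial.X * Polynomial.C (C (w l))) F :
    Polynomial (MvPolynomial τ K)).coeff i, fun v => ?_⟩
  rw [← Polynomial.coeff_map]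
  congr 1
  induction F using MvPolynomial.induction_on with
  | C c => simp [lineEval]
  | add f g hf hg => rw [map_add, map_add, Polynomial.map_add, hf, hg]
  | mul_X f i hf =>
    rw [map_mul, map_mul, Polynomial.map_mul, hf]
    congr 1
    simp [lineEval]

/-- Semicontinuity: if no nonzero polynomial of degree less than `T` vanishes to order `M` along
the lines spanned by the vectors `v₀ j`, then the same holds for general vectors. -/
lemma exists_generic_eq_zero {ι σ : Type} [Finite σ] {T : ℕ} (hT : 0 < T) (M : ℕ) (v₀ : ι → σ → K)
    (h : ∀ F : MvPolynomial σ K, F.totalDegree < T →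
      (∀ j (c : K), VanishesToOrder F M (c • v₀ j)) → F = 0) :
    ∃ G : MvPolynomial (ι × σ) K, G ≠ 0 ∧ ∀ v : ι → σ → K, eval (fun p => v p.1 p.2) G ≠ 0 →
      ∀ F : MvPolynomial σ K, F.totalDegree < T →
        (∀ j (c : K), VanishesToOrder F M (c • v j)) → F = 0 := by
  classical
  let D := (Finsupp.finite_of_degree_lt (σ := σ) T).toFinset
  have hD : ∀ b, b ∈ D ↔ b.degree < T := fun b => by simp [D]
  choose P hP using fun (r : ι × K × (σ → K) × Fin M) (b : D) =>
    exists_eval_eq_lineEval (monomial b.1 (1 : K)) (fun l => (r.1, l)) r.2.2.1 r.2.1 r.2.2.2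
  let poly (x : D → K) : MvPolynomial σ K := ∑ b, x b • monomial b.1 (1 : K)
  have hcoeff : ∀ x b, (poly x).coeff b.1 = x b := fun x b => by
    simp [poly, coeff_sum, coeff_monomial, Subtype.ext_iff.symm]
  have hsum : ∀ (v : ι → σ → K) r x, ∑ b, eval (fun p => v p.1 p.2) (P r b) * x b =
      (lineEval (r.2.1 • v r.1) r.2.2.1 (poly x)).coeff r.2.2.2 := fun v r x => by
    simp only [hP, poly, map_sum, map_smul, Polynomial.finsetSum_coeff, Polynomial.coeff_smul,
      smul_eq_mul]
    exact Finset.sum_congr rfl fun b _ => mul_comm _ _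
  obtain ⟨G, hG0, hG⟩ := exists_ne_zero_of_forall_eq_zero P (fun p => v₀ p.1 p.2) (fun x hx => by
    have : poly x = 0 := by
      refine h _ ?_ fun j c w => Polynomial.X_pow_dvd_iff.2 fun i hi => ?_
      · refine (Finset.sup_lt_iff hT).2 fun b hb => ?_
        by_contra hbD
        refine mem_support_iff.1 hb ?_
        simp only [poly, coeff_sum, coeff_smul, coeff_monomial]
        refine Finset.sum_eq_zero fun b' _ => ?_
        rw [if_neg, smul_zero]
        rintro rfl
        exact hbD ((hD _).1 b'.2)
      · rw [← hx (j, c, w, ⟨i, hi⟩), hsum]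
    ext b
    rw [← hcoeff x, this, coeff_zero, Pi.zero_apply])
  refine ⟨G, hG0, fun v hv F hF hFv => ?_⟩
  have hFp : poly (fun b => F.coeff b.1) = F := by
    ext b
    by_cases hb : b ∈ D
    · exact hcoeff _ ⟨b, hb⟩
    · have hb' := mt (hD b).2 hb
      rw [coeff_eq_zero_of_totalDegree_lt (f := F) (hF.trans_le (not_lt.1 hb'))]
      simp only [poly, coeff_sum, coeff_smul, coeff_monomial]
      refine Finset.sum_eq_zero fun b' _ => ?_
      rw [if_neg, smul_zero]
      rintro rfl
      exact hb b'.2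
  have := hG _ hv (fun b => F.coeff b.1) fun r => by
    rw [hsum, hFp]
    exact Polynomial.X_pow_dvd_iff.1 (hFv _ _ _) _ r.2.2.2.2
  rw [← hFp, this]
  simp [poly]

end Generic

section StarPoints

variable {K : Type} [Field K]

/-- Plane number `i`, with coefficients the powers of `i`, so that it takes the value `q(i)` at the
coefficient vector of a cubic polynomial `q`. -/
def starForm (K : Type) [Field K] (i : ℕ) : Fin 4 → K := fun l => (i : K) ^ (l : ℕ)

/-- The coefficient vector of the polynomial with simple roots at the elements of `S`, the point
of the star configuration lying on the planes indexed by `S`. -/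
def starPoint (K : Type) [Field K] (S : Finset ℕ) : Fin 4 → K :=
  fun l => (∏ j ∈ S, (Polynomial.X - Polynomial.C (j : K))).coeff l

lemma starForm_dotProduct_coeff (i : ℕ) {q : Polynomial K} (hq : q.natDegree < 4) :
    starForm K i ⬝ᵥ (fun l : Fin 4 => q.coeff l) = q.eval (i : K) := by
  rw [Polynomial.eval_eq_sum_range' hq, ← Fin.sum_univ_eq_sum_range]
  exact Finset.sum_congr rfl fun l _ => mul_comm _ _

lemma natDegree_prod_X_sub_C (S : Finset ℕ) :
    (∏ j ∈ S, (Polynomial.X - Polynomial.C (j : K))).natDegree = S.card := by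
  rw [Polynomial.natDegree_prod_of_monic _ _ fun j _ => Polynomial.monic_X_sub_C _,
    Finset.card_eq_sum_ones]
  exact Finset.sum_congr rfl fun _ _ => Polynomial.natDegree_X_sub_C _

lemma starForm_dotProduct_starPoint (i : ℕ) {S : Finset ℕ} (hS : S.card ≤ 3) :
    starForm K i ⬝ᵥ starPoint K S = ∏ j ∈ S, ((i : K) - j) := by
  unfold starPoint
  rw [starForm_dotProduct_coeff i (by rw [natDegree_prod_X_sub_C]; lia),
    Polynomial.eval_prod]
  simp

lemma starPoint_mem_linLocus {S : Finset ℕ} (hS : S.card ≤ 3) :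
    starPoint K S ∈ linLocus (starForm K) S := fun i hi => by
  rw [starForm_dotProduct_starPoint i hS]
  exact Finset.prod_eq_zero hi (sub_self _)

lemma generalForms_starForm [CharZero K] (I : Finset ℕ) : GeneralForms (starForm K) I 3 := by
  intro S _ hS i _ hi
  refine ⟨starPoint K S, starPoint_mem_linLocus hS, ?_⟩
  rw [starForm_dotProduct_starPoint i hS]
  refine Finset.prod_ne_zero_iff.2 fun j hj => sub_ne_zero.2 fun h => hi ?_
  rwa [Nat.cast_injective h]

lemma exists_eq_smul_starPoint [CharZero K] {S : Finset ℕ} (hS : S.card = 3) {p : Fin 4 → K}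
    (hp : p ∈ linLocus (starForm K) S) : ∃ c : K, p = c • starPoint K S := by
  have h3 : starPoint K S 3 = 1 := by
    have := (Polynomial.monic_prod_of_monic S (fun j : ℕ => Polynomial.X - Polynomial.C (j : K))
      fun j _ => Polynomial.monic_X_sub_C _).coeff_natDegree
    rwa [natDegree_prod_X_sub_C, hS] at this
  refine ⟨p 3, sub_eq_zero.1 ?_⟩
  set q := p - p 3 • starPoint K S with hq
  have hq3 : q 3 = 0 := by simp [hq, h3]
  have hqS : q ∈ linLocus (starForm K) S :=
    sub_mem hp (Submodule.smul_mem _ _ (starPoint_mem_linLocus hS.le))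
  let Q : Polynomial K := ∑ l : Fin 3, Polynomial.C (q l.castSucc) * Polynomial.X ^ (l : ℕ)
  have hQ : Q = 0 := by
    refine Polynomial.eq_zero_of_degree_lt_of_eval_index_eq_zero (v := fun j : ℕ => (j : K))
      (s := S) (fun i _ j _ h => Nat.cast_injective h) ?_ fun j hj => ?_
    · rw [hS]
      exact Polynomial.degree_sum_fin_lt fun l : Fin 3 => q l.castSucc
    · have := hqS j hj
      simp only [dotProduct, Fin.sum_univ_four, hq3, starForm] at this
      simp only [Q, Fin.sum_univ_three, Polynomial.eval_add, Polynomial.eval_mul,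
        Polynomial.eval_C, Polynomial.eval_pow, Polynomial.eval_X]
      rw [← this]
      simp
      ring
  have hc : ∀ n, Q.coeff n = 0 := by simp [hQ]
  have h0 := hc 0
  have h1 := hc 1
  have h2 := hc 2
  simp [Q, Fin.sum_univ_three, Polynomial.coeff_X, Polynomial.coeff_X_pow] at h0 h1 h2
  ext l
  fin_cases l <;> simp_all

lemma exists_starPoint_tuple {n s : ℕ} (hn : s.choose 3 ≤ n) :
    ∃ v : Fin n → Fin 4 → K, ∀ S ⊆ Finset.range s, S.card = 3 → ∃ j, v j = starPoint K S := by
  refine ⟨fun j => starPoint K (((Finset.range s).powersetCard 3).toList.getD j ∅),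
    fun S hS hS3 => ?_⟩
  have hmem : S ∈ ((Finset.range s).powersetCard 3).toList := by
    simp [Finset.mem_powersetCard, hS, hS3]
  obtain ⟨i, hi, rfl⟩ := List.mem_iff_getElem.1 hmem
  have hin : i < n := by
    refine lt_of_lt_of_le hi ?_
    rwa [Finset.length_toList, Finset.card_powersetCard, Finset.card_range]
  exact ⟨⟨i, hin⟩, congrArg (starPoint K) (List.getD_eq_getElem _ ∅ hi)⟩

end StarPoints

section PointIdeal

variable {K : Type} [Field K]

lemma aeval_mul_of_isHomogeneous {σ A : Type} [CommRing A] [Algebra K A] {F : MvPolynomial σ K}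
    {d : ℕ} (hF : F.IsHomogeneous d) (a : σ → K) (y : A) :
    aeval (fun l => y * algebraMap K A (a l)) F = y ^ d * algebraMap K A (eval a F) := by
  rw [aeval_def, eval₂_eq, eval_eq, map_sum, Finset.mul_sum]
  refine Finset.sum_congr rfl fun b hb => ?_
  have hbd : ∑ i ∈ b.support, b i = d := by
    rw [← Finsupp.degree_apply, Finsupp.degree_eq_weight_one]
    exact hF (mem_support_iff.1 hb)
  simp only [mul_pow, Finset.prod_mul_distrib, Finset.prod_pow_eq_pow_sum, hbd, map_mul, map_prod,
    map_pow]
  ring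

lemma vanishesToOrder_of_mem_pointIdeal_pow {v : Fin 4 → K} {M : ℕ} {F : MvPolynomial (Fin 4) K}
    (hF : F ∈ pointIdeal K v ^ M) (c : K) : VanishesToOrder F M (c • v) := by
  intro w
  rw [← Ideal.mem_span_singleton, ← Ideal.span_singleton_pow]
  have h : pointIdeal K v ≤
      (Ideal.span {(Polynomial.X : Polynomial K)}).comap (lineEval (c • v) w) := by
    refine Ideal.span_le.2 ?_
    rintro f ⟨hf, hfv⟩
    rw [SetLike.mem_coe, Ideal.mem_comap, Ideal.mem_span_singleton, Polynomial.X_dvd_iff,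
      coeff_zero_lineEval]
    have := aeval_mul_of_isHomogeneous hf v c
    rw [hfv, map_zero, mul_zero] at this
    exact this
  exact (Ideal.le_comap_pow _ M) (Ideal.pow_right_mono h M hF)

lemma mem_pointIdeal {v : Fin 4 → K} (hv : v ≠ 0) {d : ℕ} {F : MvPolynomial (Fin 4) K}
    (hF : F.IsHomogeneous d) (hFv : eval v F = 0) : F ∈ pointIdeal K v := by
  obtain ⟨i, hi⟩ := Function.ne_iff.1 hv
  rw [Pi.zero_apply] at hi
  let g : Fin 4 → MvPolynomial (Fin 4) K := fun l => C (v i)⁻¹ * X i * C (v l)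
  have hg : aeval g F = 0 := by
    have := aeval_mul_of_isHomogeneous hF v (C (v i)⁻¹ * X i : MvPolynomial (Fin 4) K)
    rwa [hFv, map_zero, mul_zero] at this
  have hmk : Ideal.Quotient.mkₐ K (pointIdeal K v) =
      (Ideal.Quotient.mkₐ K (pointIdeal K v)).comp (aeval g) := by
    refine algHom_ext fun l => ?_
    rw [AlgHom.comp_apply, aeval_X]
    refine Ideal.Quotient.eq.2 (Ideal.subset_span ⟨(isHomogeneous_X K l).sub ?_, ?_⟩)
    · simpa using ((isHomogeneous_C _ _).mul (isHomogeneous_X K i)).mul (isHomogeneous_C _ (v l))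
    · simp [g, hi]
  have := congrArg (fun φ => φ F) hmk
  simp only [AlgHom.comp_apply, hg, map_zero] at this
  exact Ideal.Quotient.eq_zero_iff_mem.1 this

lemma exists_isHomogeneous_eval_eq_zero {n d : ℕ} (hn : n < (d + 3).choose 3)
    (v : Fin n → Fin 4 → K) :
    ∃ F : MvPolynomial (Fin 4) K, F ≠ 0 ∧ F.IsHomogeneous d ∧ ∀ j, eval (v j) F = 0 := by
  let D := Finset.univ.finsuppAntidiag d (ι := Fin 4)
  let poly : (D → K) →ₗ[K] MvPolynomial (Fin 4) K := ∑ b : D, (monomial b.1).comp (LinearMap.proj b)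
  have hpoly : ∀ x, poly x = ∑ b : D, monomial b.1 (x b) := fun x => by simp [poly]
  have hcard : D.card = (d + 3).choose 3 := by
    rw [Finset.card_finsuppAntidiag_nat_eq_choose, Finset.card_univ, Fintype.card_fin,
      show 4 + d - 1 = d + 3 by lia, ← Nat.choose_symm_add]
  let ev : (D → K) →ₗ[K] (Fin n → K) := LinearMap.pi fun j => (aeval (v j)).toLinearMap ∘ₗ poly
  obtain ⟨x, hx, hx0⟩ := (Submodule.ne_bot_iff _).1
    (LinearMap.ker_ne_bot_of_finrank_lt (f := ev) (by simpa [hcard] using hn))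
  refine ⟨poly x, fun h0 => hx0 ?_, ?_, fun j => congrFun hx j⟩
  · ext b
    have := congrArg (coeff b.1) h0
    simpa [hpoly, coeff_sum, coeff_monomial, Subtype.ext_iff.symm] using this
  · rw [hpoly]
    refine IsHomogeneous.sum _ _ _ fun b _ => isHomogeneous_monomial _ ?_
    have := (Finset.mem_finsuppAntidiag.1 b.2).1
    rwa [Finsupp.degree_eq_sum]

end PointIdeal

theorem generalized_chudnovsky (K : Type) [Field K] [CharZero K] (n m k : ℕ)
    (hn : 1 ≤ n) (hm : 1 ≤ m) (hk : k ≤ 2) :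
    ∃ G : MvPolynomial (Fin n × Fin 4) K, G ≠ 0 ∧
      ∀ v : Fin n → Fin 4 → K, (∀ j, v j ≠ 0) →
        eval (fun p => v p.1 p.2) G ≠ 0 →
        m * alphaDeg (⨅ j, pointIdeal K (v j)) + 2 * m - k ≤
          alphaDeg (⨅ j, pointIdeal K (v j) ^ (3 * m - k)) := by
  have hex : ∃ d, n < (d + 3).choose 3 := by
    refine ⟨n, ?_⟩
    clear hn
    induction n with
    | zero => simp
    | succ n ih =>
      have h1 : (n + 1 + 3).choose 3 = (n + 3).choose 2 + (n + 3).choose 3 := rfl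
      have h2 : 0 < (n + 3).choose 2 := Nat.choose_pos (by lia)
      lia
  obtain ⟨d, hd, hdmin⟩ : ∃ d, n < (d + 1 + 3).choose 3 ∧ (d + 3).choose 3 ≤ n := by
    classical
    obtain ⟨d, hd⟩ : ∃ d, Nat.find hex = d + 1 := Nat.exists_eq_succ_of_ne_zero fun h0 => by
      have := Nat.find_spec hex
      rw [h0] at this
      simp at this
      lia
    exact ⟨d, hd ▸ Nat.find_spec hex, not_lt.1 (Nat.find_min hex (m := d) (by lia))⟩
  obtain ⟨v₀, hv₀⟩ := exists_starPoint_tuple (K := K) hdmin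
  have hmd : m ≤ m * (d + 3) := Nat.le_mul_of_pos_right _ (by lia)
  have hmd' : m * (d + 3) = m * (d + 1) + 2 * m := by ring
  obtain ⟨G, hG0, hG⟩ := exists_generic_eq_zero (T := m * (d + 3) - k) (by lia) (3 * m - k) v₀
    fun F hF hFv => by
      refine eq_zero_of_vanishesToOrder_star 3 (Finset.range (d + 3)) (starForm K) m k F (by lia)
        (by simp) (generalForms_starForm _) (by lia) (fun S hS hS3 p hp => ?_)
        (by rw [Finset.card_range]; lia)
      obtain ⟨c, rfl⟩ := exists_eq_smul_starPoint hS3 hp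
      obtain ⟨j, hj⟩ := hv₀ S hS hS3
      exact hj ▸ hFv j c
  refine ⟨G, hG0, fun v hv hGv => ?_⟩
  obtain ⟨F, hF0, hFd, hFv⟩ := exists_isHomogeneous_eval_eq_zero hd v
  have hFI : ∀ j, F ∈ pointIdeal K (v j) := fun j => mem_pointIdeal (hv j) hFd (hFv j)
  have hα : alphaDeg (⨅ j, pointIdeal K (v j)) ≤ d + 1 :=
    Nat.sInf_le ⟨F, Ideal.mem_iInf.2 hFI, hF0, hFd⟩
  have hne :
      {t | ∃ f ∈ ⨅ j, pointIdeal K (v j) ^ (3 * m - k), f ≠ 0 ∧ f.IsHomogeneous t}.Nonempty :=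
    ⟨_, F ^ (3 * m - k), Ideal.mem_iInf.2 fun j => Ideal.pow_mem_pow (hFI j) _,
      pow_ne_zero _ hF0, hFd.pow _⟩
  obtain ⟨f, hfI, hf0, hf⟩ := Nat.sInf_mem hne
  have hT : m * (d + 3) - k ≤ alphaDeg (⨅ j, pointIdeal K (v j) ^ (3 * m - k)) := by
    by_contra! hlt
    refine hf0 (hG v hGv f (hf.totalDegree_le.trans_lt hlt) fun j c => ?_)
    exact vanishesToOrder_of_mem_pointIdeal_pow (Ideal.mem_iInf.1 hfI j) c
  have := Nat.mul_le_mul_left m hα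
  lia

end
end

section
/- Let t, m_1,…,m_8 be integers, and set s_1 = m_1+m_2+m_3+m_4 and s_2 = m_5+m_6+m_7+m_8. Let F : ℤ × ℤ^8 → ℤ × ℤ^8 be the composite of the Cremona move on indices {1,2,3,4} followed by the Cremona move on indices {5,6,7,8}, and write F^n(t,(m_1,…,m_8)) = (T(n), M(n)). Then for all n ≥ 0: T(n) = (8n²+1)t − (2n²+n)s_1 − (2n²−n)s_2, the sum of the first four entries of M(n) equals (16n²−8n)t − (4n²−1)s_1 − (4n²−4n)s_2, and the sum of the last four entries of M(n) equals (16n²+8n)t − (4n²+4n)s_1 − (4n²−1)s_2. -/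
open Filter

/-- The arithmetic Cremona move based at the four indices in `S`: the degree `t`
becomes `t + k` and each multiplicity `mᵢ` with `i ∈ S` becomes `mᵢ + k`, where
`k = 2t − Σ_{i∈S} mᵢ`. -/
def cremona {N : ℕ} (S : Finset (Fin N)) (p : ℤ × (Fin N → ℤ)) : ℤ × (Fin N → ℤ) :=
  let k : ℤ := 2 * p.1 - ∑ i ∈ S, p.2 i
  (p.1 + k, fun i => if i ∈ S then p.2 i + k else p.2 i)

theorem cremona_fst {N : ℕ} (S : Finset (Fin N)) (p : ℤ × (Fin N → ℤ)) :
    (cremona S p).1 = 3 * p.1 - ∑ i ∈ S, p.2 i := by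
  simp only [cremona]
  ring

theorem sum_cremona_self {N : ℕ} (S : Finset (Fin N)) (p : ℤ × (Fin N → ℤ)) :
    ∑ i ∈ S, (cremona S p).2 i =
      ∑ i ∈ S, p.2 i + S.card * (2 * p.1 - ∑ i ∈ S, p.2 i) := by
  simp only [cremona]
  rw [Finset.sum_congr rfl fun i hi => if_pos hi, Finset.sum_add_distrib, Finset.sum_const,
    nsmul_eq_mul]

theorem sum_cremona_of_disjoint {N : ℕ} {S R : Finset (Fin N)} (h : Disjoint R S)
    (p : ℤ × (Fin N → ℤ)) : ∑ i ∈ R, (cremona S p).2 i = ∑ i ∈ R, p.2 i :=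
  Finset.sum_congr rfl fun _ hi => if_neg (Finset.disjoint_left.mp h hi)

theorem cremona_iterate_formula (t : ℤ) (m : Fin 8 → ℤ) :
    ∀ n : ℕ,
      ((cremona ({4, 5, 6, 7} : Finset (Fin 8)) ∘
          cremona ({0, 1, 2, 3} : Finset (Fin 8)))^[n] (t, m)).1 =
        (8 * (n : ℤ) ^ 2 + 1) * t - (2 * (n : ℤ) ^ 2 + n) * (m 0 + m 1 + m 2 + m 3)
          - (2 * (n : ℤ) ^ 2 - n) * (m 4 + m 5 + m 6 + m 7) ∧
      (∑ i ∈ ({0, 1, 2, 3} : Finset (Fin 8)),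
          ((cremona ({4, 5, 6, 7} : Finset (Fin 8)) ∘
            cremona ({0, 1, 2, 3} : Finset (Fin 8)))^[n] (t, m)).2 i) =
        (16 * (n : ℤ) ^ 2 - 8 * n) * t - (4 * (n : ℤ) ^ 2 - 1) * (m 0 + m 1 + m 2 + m 3)
          - (4 * (n : ℤ) ^ 2 - 4 * n) * (m 4 + m 5 + m 6 + m 7) ∧
      (∑ i ∈ ({4, 5, 6, 7} : Finset (Fin 8)),
          ((cremona ({4, 5, 6, 7} : Finset (Fin 8)) ∘
            cremona ({0, 1, 2, 3} : Finset (Fin 8)))^[n] (t, m)).2 i) =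
        (16 * (n : ℤ) ^ 2 + 8 * n) * t - (4 * (n : ℤ) ^ 2 + 4 * n) * (m 0 + m 1 + m 2 + m 3)
          - (4 * (n : ℤ) ^ 2 - 1) * (m 4 + m 5 + m 6 + m 7) := by
  intro n
  have hd : Disjoint ({0, 1, 2, 3} : Finset (Fin 8)) {4, 5, 6, 7} := by decide
  have hA : ({0, 1, 2, 3} : Finset (Fin 8)).card = 4 := by decide
  have hB : ({4, 5, 6, 7} : Finset (Fin 8)).card = 4 := by decide
  induction n with
  | zero =>
    refine ⟨by simp, ?_, ?_⟩ <;> simp <;> ring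
  | succ n ih =>
    obtain ⟨hT, h₁, h₂⟩ := ih
    simp only [Function.iterate_succ_apply', Function.comp_apply, cremona_fst, sum_cremona_self,
      sum_cremona_of_disjoint hd, sum_cremona_of_disjoint hd.symm, hA, hB]
    rw [hT, h₁, h₂]
    push_cast
    refine ⟨?_, ?_, ?_⟩ <;> ring
end

section
/- Let t, m_1,…,m_8 be integers with 4t > m_1 + m_2 + … + m_8. Let F : ℤ × ℤ^8 → ℤ × ℤ^8 be the composite of the Cremona move on indices {1,2,3,4} followed by the Cremona move on indices {5,6,7,8}, and let T(n) be the first coordinate of F^n(t,(m_1,…,m_8)). Then T(n) tends to +∞ as n → ∞; in particular T(n) takes arbitrarily large values. -/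
open Filter

/-- The composite of the Cremona moves on the first four and on the last four of eight indices. -/
def cremonaPair : ℤ × (Fin 8 → ℤ) → ℤ × (Fin 8 → ℤ) :=
  cremona ({4, 5, 6, 7} : Finset (Fin 8)) ∘ cremona ({0, 1, 2, 3} : Finset (Fin 8))

/-- The excess `4t − Σ mᵢ`, which is invariant under `cremonaPair`. -/
def cremonaExcess (p : ℤ × (Fin 8 → ℤ)) : ℤ := 4 * p.1 - ∑ i, p.2 i

/-- The increment `2t − (m₀ + m₁ + m₂ + m₃)` of the first Cremona move. -/
def cremonaIncrement (p : ℤ × (Fin 8 → ℤ)) : ℤ :=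
  2 * p.1 - ∑ i ∈ ({0, 1, 2, 3} : Finset (Fin 8)), p.2 i

theorem cremonaExcess_cremonaPair (p : ℤ × (Fin 8 → ℤ)) :
    cremonaExcess (cremonaPair p) = cremonaExcess p := by
  simp [cremonaExcess, cremonaPair, cremona, Fin.sum_univ_eight]
  ring

theorem cremonaIncrement_cremonaPair (p : ℤ × (Fin 8 → ℤ)) :
    cremonaIncrement (cremonaPair p) = cremonaIncrement p + 2 * cremonaExcess p := by
  simp [cremonaIncrement, cremonaExcess, cremonaPair, cremona, Fin.sum_univ_eight]
  ring

theorem cremonaPair_fst (p : ℤ × (Fin 8 → ℤ)) :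
    (cremonaPair p).1 = p.1 + cremonaExcess p + 2 * cremonaIncrement p := by
  simp [cremonaIncrement, cremonaExcess, cremonaPair, cremona, Fin.sum_univ_eight]
  ring

/-- The degree of the iterates of `cremonaPair` is an explicit quadratic polynomial. -/
theorem cremonaPair_iterate_fst (n : ℕ) (p : ℤ × (Fin 8 → ℤ)) :
    (cremonaPair^[n] p).1 =
      p.1 + 2 * cremonaIncrement p * n + cremonaExcess p * (n * (2 * n - 1)) := by
  induction n generalizing p with
  | zero => simp
  | succ n ih =>
    rw [Function.iterate_succ_apply, ih, cremonaExcess_cremonaPair,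
      cremonaIncrement_cremonaPair, cremonaPair_fst]
    push_cast
    ring

theorem cremona_iterate_tendsto_atTop (t : ℤ) (m : Fin 8 → ℤ)
    (h : 4 * t > ∑ i, m i) :
    Tendsto (fun n : ℕ =>
      ((cremona ({4, 5, 6, 7} : Finset (Fin 8)) ∘
        cremona ({0, 1, 2, 3} : Finset (Fin 8)))^[n] (t, m)).1) atTop atTop := by
  change Tendsto (fun n : ℕ => (cremonaPair^[n] (t, m)).1) atTop atTop
  have hD : 1 ≤ cremonaExcess (t, m) := by
    dsimp only [cremonaExcess]
    omega
  refine tendsto_atTop_mono' atTop ?_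
    (tendsto_atTop_add_const_left atTop t tendsto_natCast_atTop_atTop)
  filter_upwards [eventually_ge_atTop (1 - cremonaIncrement (t, m)).toNat,
    eventually_ge_atTop 1] with n hn hn1
  rw [cremonaPair_iterate_fst]
  have hn' : 1 - cremonaIncrement (t, m) ≤ n := Int.toNat_le.mp hn
  have hn1' : (1 : ℤ) ≤ n := by exact_mod_cast hn1
  have hquad : 0 ≤ (n : ℤ) * (2 * n - 1) := mul_nonneg (by linarith) (by linarith)
  nlinarith [mul_nonneg (sub_nonneg.2 hD) hquad]
end

section
/- Let F : ℤ × ℤ^{10} → ℤ × ℤ^{10} be the composite of the Cremona moves on indices {1,2,3,4}, then {1,5,6,7}, then {1,8,9,10}. Then for every n ≥ 0, F^{2n}(1,(0,0,0,0,0,0,0,0,0,0)) = (54n²+1, (54n², 18n²−6n, 18n²−6n, 18n²−6n, 18n², 18n², 18n², 18n²+6n, 18n²+6n, 18n²+6n)). Consequently the first coordinate of F^n(1,(0,…,0)) tends to +∞ as n → ∞. -/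
open Filter

/-- The composite of the Cremona moves on indices {1,2,3,4}, then {1,5,6,7},
then {1,8,9,10} (0-indexed: {0,1,2,3}, {0,4,5,6}, {0,7,8,9}). -/
def F3 : ℤ × (Fin 10 → ℤ) → ℤ × (Fin 10 → ℤ) :=
  cremona ({0, 7, 8, 9} : Finset (Fin 10)) ∘ cremona ({0, 4, 5, 6} : Finset (Fin 10)) ∘
    cremona ({0, 1, 2, 3} : Finset (Fin 10))

/-- The class of degree `t` on ten points whose multiplicity is `a` at the common base point
and `b`, `c`, `d` on the remaining three blocks of three points. -/
def blockClass (t a b c d : ℤ) : ℤ × (Fin 10 → ℤ) :=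
  (t, fun i => if i = 0 then a else if i.val ≤ 3 then b else if i.val ≤ 6 then c else d)

theorem cremona_first_block (t a b c d : ℤ) :
    cremona ({0, 1, 2, 3} : Finset (Fin 10)) (blockClass t a b c d) =
      blockClass (3 * t - a - 3 * b) (2 * t - 3 * b) (2 * t - a - 2 * b) c d := by
  ext i
  · simp [cremona, blockClass]
    ring
  · fin_cases i <;> simp [cremona, blockClass] <;> ring

theorem cremona_second_block (t a b c d : ℤ) :
    cremona ({0, 4, 5, 6} : Finset (Fin 10)) (blockClass t a b c d) =
      blockClass (3 * t - a - 3 * c) (2 * t - 3 * c) b (2 * t - a - 2 * c) d := by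
  ext i
  · simp [cremona, blockClass]
    ring
  · fin_cases i <;> simp [cremona, blockClass] <;> ring

theorem cremona_third_block (t a b c d : ℤ) :
    cremona ({0, 7, 8, 9} : Finset (Fin 10)) (blockClass t a b c d) =
      blockClass (3 * t - a - 3 * d) (2 * t - 3 * d) b c (2 * t - a - 2 * d) := by
  ext i
  · simp [cremona, blockClass]
    ring
  · fin_cases i <;> simp [cremona, blockClass] <;> ring

/-- The value of the even iterates of `F3` on the class of a plane. -/
def evenOrbit (n : ℤ) : ℤ × (Fin 10 → ℤ) :=
  blockClass (54 * n ^ 2 + 1) (54 * n ^ 2) (18 * n ^ 2 - 6 * n) (18 * n ^ 2)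
    (18 * n ^ 2 + 6 * n)

theorem F3_evenOrbit (n : ℤ) :
    F3 (evenOrbit n) =
      blockClass (54 * n ^ 2 + 54 * n + 15) (54 * n ^ 2 + 54 * n + 14)
        (18 * n ^ 2 + 12 * n + 2) (18 * n ^ 2 + 18 * n + 4) (18 * n ^ 2 + 24 * n + 8) := by
  simp only [F3, Function.comp_apply, evenOrbit, cremona_first_block, cremona_second_block,
    cremona_third_block]
  congr 1 <;> ring

theorem F3_F3_evenOrbit (n : ℤ) : F3 (F3 (evenOrbit n)) = evenOrbit (n + 1) := by
  rw [F3_evenOrbit]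
  simp only [F3, Function.comp_apply, evenOrbit, cremona_first_block, cremona_second_block,
    cremona_third_block]
  congr 1 <;> ring

theorem F3_iterate_even (n : ℕ) : F3^[2 * n] (1, fun _ => 0) = evenOrbit n := by
  induction n with
  | zero => simp [evenOrbit, blockClass]
  | succ n ih =>
    rw [show 2 * (n + 1) = 2 * n + 1 + 1 by ring, Function.iterate_succ_apply',
      Function.iterate_succ_apply', ih, F3_F3_evenOrbit, Nat.cast_succ]

theorem le_F3_iterate_fst (m : ℕ) : (m : ℤ) ≤ (F3^[m] (1, fun _ => 0)).1 := by
  obtain ⟨n, rfl | rfl⟩ := Nat.even_or_odd' m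
  · rw [F3_iterate_even]
    simp only [evenOrbit, blockClass]
    push_cast
    nlinarith [sq_nonneg ((n : ℤ) - 1)]
  · rw [Function.iterate_succ_apply', F3_iterate_even, F3_evenOrbit]
    simp only [blockClass]
    push_cast
    nlinarith [sq_nonneg (n : ℤ)]

theorem cremona_three_moves_iterate :
    (∀ n : ℕ, F3^[2 * n] (1, fun _ => 0) =
      (54 * (n : ℤ) ^ 2 + 1, fun i : Fin 10 =>
        if i = 0 then 54 * (n : ℤ) ^ 2
        else if i.val ≤ 3 then 18 * (n : ℤ) ^ 2 - 6 * n
        else if i.val ≤ 6 then 18 * (n : ℤ) ^ 2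
        else 18 * (n : ℤ) ^ 2 + 6 * n)) ∧
    Tendsto (fun n : ℕ => (F3^[n] (1, fun _ => 0)).1) atTop atTop := by
  exact ⟨F3_iterate_even, tendsto_atTop_mono le_F3_iterate_fst tendsto_natCast_atTop_atTop⟩
end

section
/- Let K be a field of characteristic zero, R = K[x_0,x_1,x_2,x_3], and let e_1,e_2,e_3,e_4 be the standard basis vectors of K^4, so that m_{e_j} is the ideal of R generated by the three variables x_i with i ≠ j−1. Then for every integer m ≥ 1, the ideal ⋂_{j=1}^4 m_{e_j}^{3m} contains no nonzero homogeneous polynomial of degree 4m−1; equivalently, for the ideal I = ⋂_{j=1}^4 m_{e_j} of the four coordinate points of P^3 one has α(I^{(3m)}) ≥ 4m (so the Waldschmidt constant of I is at least 4/3). -/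
open MvPolynomial Filter

noncomputable section

/-- The vanishing ideal of the coordinate point `e_j` of `ℙ³`: the ideal generated by
the three variables `xᵢ` with `i ≠ j`. -/
def coordIdeal4 (K : Type) [Field K] (j : Fin 4) : Ideal (MvPolynomial (Fin 4) K) :=
  Ideal.span {f | ∃ i, i ≠ j ∧ f = X i}

theorem le_weight_of_mem_coordIdeal4_pow {K : Type} [Field K] (j : Fin 4) (n : ℕ)
    {f : MvPolynomial (Fin 4) K} (hf : f ∈ coordIdeal4 K j ^ n) {d : Fin 4 →₀ ℕ}
    (hd : d ∈ f.support) : n ≤ ∑ i ∈ Finset.univ.erase j, d i := by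
  induction n generalizing f d with
  | zero => exact Nat.zero_le _
  | succ n ih =>
    rw [pow_succ] at hf
    induction hf using Submodule.mul_induction_on' generalizing d with
    | mem_mul_mem p hp q hq =>
      obtain ⟨a, ha, b, hb, rfl⟩ := Finset.mem_add.mp (support_mul p q hd)
      have hS : {f : MvPolynomial (Fin 4) K | ∃ i, i ≠ j ∧ f = X i} = X '' {i | i ≠ j} := by
        ext f
        simp [eq_comm]
      rw [coordIdeal4, hS, mem_ideal_span_X_image] at hq
      obtain ⟨i, hi, hbi⟩ := hq b hb
      have h₁ : b i ≤ ∑ i ∈ Finset.univ.erase j, b i :=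
        Finset.single_le_sum (f := fun i => b i) (fun _ _ => Nat.zero_le _) (by simpa using hi)
      have h₂ := ih hp ha
      simp only [Finsupp.add_apply, Finset.sum_add_distrib]
      lia
    | add p _ q _ hp hq =>
      rcases Finset.mem_union.mp (support_add hd) with h | h
      · exact hp h
      · exact hq h

/-- A nonzero form vanishing to order `n` at the four coordinate points has degree at least
`4n/3`. -/
theorem four_mul_le_three_mul_of_mem_iInf {K : Type} [Field K] {n t : ℕ}
    {f : MvPolynomial (Fin 4) K} (hf : f ∈ ⨅ j : Fin 4, coordIdeal4 K j ^ n) (hf0 : f ≠ 0)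
    (ht : f.IsHomogeneous t) : 4 * n ≤ 3 * t := by
  obtain ⟨d, hd⟩ := support_nonempty.mpr hf0
  have hdeg : ∑ i, d i = t := by
    rw [← Finsupp.degree_eq_sum, Finsupp.degree_eq_weight_one]
    exact ht (mem_support_iff.mp hd)
  have h (j : Fin 4) : n + d j ≤ t := by
    have := le_weight_of_mem_coordIdeal4_pow j n (Ideal.mem_iInf.mp hf j) hd
    rw [← hdeg, ← Finset.sum_erase_add _ _ (Finset.mem_univ j)]
    lia
  rw [Fin.sum_univ_four] at hdeg
  have := h 0
  have := h 1
  have := h 2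
  have := h 3
  lia

theorem prod_X_mem_coordIdeal4_pow_three {K : Type} [Field K] (j : Fin 4) :
    (∏ i, X i : MvPolynomial (Fin 4) K) ∈ coordIdeal4 K j ^ 3 := by
  rw [← Finset.prod_erase_mul _ _ (Finset.mem_univ j)]
  refine Ideal.mul_mem_right _ _ ?_
  have hcard : (Finset.univ.erase j).card = 3 := by simp
  rw [← hcard, ← Finset.prod_const]
  exact Ideal.prod_mem_prod fun i hi => Ideal.subset_span ⟨i, Finset.ne_of_mem_erase hi, rfl⟩

/-- For the ideal `I` of the four coordinate points of `ℙ³`, the symbolic power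
`I^(3m)` contains no nonzero homogeneous polynomial of degree `4m − 1`;
equivalently `α(I^(3m)) ≥ 4m`. -/
theorem four_points_alpha_bound (K : Type) [Field K] [CharZero K] (m : ℕ) (hm : 1 ≤ m) :
    (∀ f ∈ ⨅ j : Fin 4, coordIdeal4 K j ^ (3 * m), f.IsHomogeneous (4 * m - 1) → f = 0) ∧
    4 * m ≤ alphaDeg (⨅ j : Fin 4, coordIdeal4 K j ^ (3 * m)) := by
  refine ⟨fun f hf ht => ?_, ?_⟩
  · by_contra hf0
    have := four_mul_le_three_mul_of_mem_iInf hf hf0 ht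
    lia
  · refine le_csInf ⟨4 * m, (∏ i, X i) ^ m, ?_, ?_, ?_⟩ ?_
    · refine Ideal.mem_iInf.mpr fun j => ?_
      rw [pow_mul]
      exact Ideal.pow_mem_pow (prod_X_mem_coordIdeal4_pow_three j) m
    · exact pow_ne_zero _ (Finset.prod_ne_zero_iff.mpr fun i _ => X_ne_zero i)
    · have h := IsHomogeneous.prod Finset.univ (fun i : Fin 4 => (X i : MvPolynomial (Fin 4) K))
        (fun _ => 1) fun i _ => isHomogeneous_X K i
      simpa using h.pow m
    · rintro t ⟨f, hf, hf0, ht⟩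
      have := four_mul_le_three_mul_of_mem_iInf hf hf0 ht
      lia

end
end

section
/- Let K be a field of characteristic zero, R = K[x_0,x_1,x_2,x_3], let e_1,e_2,e_3,e_4 be the standard basis vectors of K^4 and u = (1,1,1,1). Then for every integer m ≥ 1, the ideal m_{e_1}^{3m} ∩ m_{e_2}^{3m} ∩ m_{e_3}^{3m} ∩ m_{e_4}^{3m} ∩ m_u^{3m} contains no nonzero homogeneous polynomial of degree 5m−1; equivalently, for the ideal I of these five points of P^3 one has α(I^{(3m)}) ≥ 5m (so the Waldschmidt constant of I is at least 5/3). -/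
open MvPolynomial Filter

noncomputable section

/-- A derivation lowers membership in powers of an ideal by at most one. -/
theorem Derivation.map_mem_ideal_pow {R A : Type*} [CommSemiring R] [CommSemiring A] [Algebra R A]
    (D : Derivation R A A) (J : Ideal A) (k : ℕ) {f : A} (hf : f ∈ J ^ (k + 1)) :
    D f ∈ J ^ k := by
  induction k generalizing f with
  | zero => simp
  | succ k ih =>
    rw [pow_succ] at hf
    refine Submodule.mul_induction_on hf (fun g hg h hh => ?_) fun g h hg hh => ?_
    · rw [D.leibniz, smul_eq_mul, smul_eq_mul]
      refine add_mem (Ideal.mul_mem_right _ _ hg) ?_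
      rw [mul_comm, pow_succ]
      exact Ideal.mul_mem_mul (ih hg) hh
    · rw [map_add]
      exact add_mem hg hh

/-- The Euler operator `xᵢ ∂ᵢ` scales the coefficient of `x ^ a` by `aᵢ`. -/
theorem MvPolynomial.coeff_X_mul_pderiv {σ R : Type*} [CommSemiring R] (i : σ)
    (f : MvPolynomial σ R) (a : σ →₀ ℕ) : coeff a (X i * pderiv i f) = a i * coeff a f := by
  classical
  induction f using MvPolynomial.induction_on' with
  | monomial b r =>
    rw [X_mul_pderiv_monomial, coeff_smul, coeff_monomial]
    split_ifs with h
    · rw [h, nsmul_eq_mul]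
    · simp
  | add p q hp hq => rw [map_add, mul_add, coeff_add, hp, hq, coeff_add, mul_add]

/-- Applying the operators `xᵢ ∂ᵢ - c` for `(i, c) ∈ S` multiplies the coefficient of `x ^ a` by
`∏ (aᵢ - c)` and lowers membership in powers of an ideal by at most `#S`. -/
theorem exists_mem_pow_coeff_eq_prod_mul {σ R : Type*} [CommRing R]
    (J : Ideal (MvPolynomial σ R)) (S : Finset (σ × ℕ)) (k : ℕ) {f : MvPolynomial σ R}
    (hf : f ∈ J ^ (k + S.card)) :
    ∃ g ∈ J ^ k, ∀ a, coeff a g = (∏ p ∈ S, ((a p.1 : R) - p.2)) * coeff a f := by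
  classical
  induction S using Finset.induction_on generalizing f with
  | empty => exact ⟨f, by simpa using hf, by simp⟩
  | insert p S hp ih =>
    rw [Finset.card_insert_of_notMem hp, ← add_assoc] at hf
    have hT : X p.1 * pderiv p.1 f - C (p.2 : R) * f ∈ J ^ (k + S.card) :=
      sub_mem (Ideal.mul_mem_left _ _ ((pderiv p.1).map_mem_ideal_pow J _ hf))
        (Ideal.mul_mem_left _ _ (Ideal.pow_le_pow_right (Nat.le_succ _) hf))
    obtain ⟨g, hg, hcoeff⟩ := ih hT
    refine ⟨g, hg, fun a => ?_⟩
    rw [hcoeff, coeff_sub, coeff_X_mul_pderiv, coeff_C_mul, Finset.prod_insert hp]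
    ring

/-- If the coordinates of every exponent of a form of degree `t` are at most `N`, then vanishing
to order greater than `4 * N - t` at `(1 : 1 : 1 : 1)` forces the form to be zero. -/
theorem eq_zero_of_mem_pointIdeal_pow {K : Type} [Field K] [CharZero K] {f : MvPolynomial (Fin 4) K}
    {N t k : ℕ} (hk : 4 * N < t + k) (hf : f ∈ pointIdeal K (fun _ => (1 : K)) ^ k)
    (hhom : f.IsHomogeneous t) (hN : ∀ a ∈ f.support, ∀ i, a i ≤ N) : f = 0 := by
  classical
  have hdeg (a) (ha : a ∈ f.support) : ∑ i, a i = t := by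
    rw [← Finsupp.degree_eq_sum, Finsupp.degree_eq_weight_one]
    exact hhom (mem_support_iff.mp ha)
  by_contra hne
  obtain ⟨b, hb⟩ := Finset.nonempty_iff_ne_empty.mpr (support_eq_empty.not.mpr hne)
  let S : Finset (Fin 4 × ℕ) := Finset.univ.biUnion fun i =>
    (Finset.Ioc (b i) N).image (Prod.mk i)
  have hS (p : Fin 4 × ℕ) : p ∈ S ↔ b p.1 < p.2 ∧ p.2 ≤ N := by
    simp only [S, Finset.mem_biUnion, Finset.mem_univ, true_and, Finset.mem_image, Finset.mem_Ioc]
    constructor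
    · rintro ⟨i, c, h, rfl⟩
      exact h
    · exact fun h => ⟨p.1, p.2, h, rfl⟩
  have hcard : S.card ≤ 4 * N - t := by
    refine Finset.card_biUnion_le.trans ?_
    have h1 : ∀ i, ((Finset.Ioc (b i) N).image (Prod.mk i)).card ≤ N - b i := fun i =>
      Finset.card_image_le.trans_eq (Nat.card_Ioc _ _)
    have h2 := hdeg b hb
    have h3 := hN b hb
    refine (Finset.sum_le_sum fun i _ => h1 i).trans ?_
    simp only [Fin.sum_univ_four] at h2 ⊢
    have := h3 0; have := h3 1; have := h3 2; have := h3 3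
    omega
  have ht : t ≤ 4 * N := by
    have h2 := hdeg b hb
    have h3 := hN b hb
    simp only [Fin.sum_univ_four] at h2
    have := h3 0; have := h3 1; have := h3 2; have := h3 3
    omega
  obtain ⟨g, hg, hcoeff⟩ := exists_mem_pow_coeff_eq_prod_mul _ S 1
    (Ideal.pow_le_pow_right (by omega : 1 + S.card ≤ k) hf)
  have heval : eval (fun _ => (1 : K)) g = 0 := by
    rw [pow_one] at hg
    have hle : pointIdeal K (fun _ => (1 : K)) ≤ RingHom.ker (eval fun _ => (1 : K)) :=
      Ideal.span_le.mpr fun p hp => hp.2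
    exact hle hg
  have hother (a) (hab : a ≠ b) : coeff a g = 0 := by
    rw [hcoeff]
    by_cases ha : a ∈ f.support
    · obtain ⟨i, hi⟩ : ∃ i, b i < a i := by
        by_contra! hle
        refine hab (Finsupp.ext fun i => ?_)
        exact (Finset.sum_eq_sum_iff_of_le fun i _ => hle i).mp ((hdeg a ha).trans (hdeg b hb).symm)
          i (Finset.mem_univ i)
      rw [Finset.prod_eq_zero ((hS (i, a i)).mpr ⟨hi, hN a ha i⟩) (sub_self _), zero_mul]
    · rw [notMem_support_iff.mp ha, mul_zero]
  have hbg : coeff b g ≠ 0 := by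
    rw [hcoeff]
    refine mul_ne_zero (Finset.prod_ne_zero_iff.mpr fun p hp => ?_) (mem_support_iff.mp hb)
    exact sub_ne_zero.mpr (Nat.cast_injective.ne ((hS p).mp hp).1.ne)
  apply hbg
  rw [eval_eq', Finset.sum_eq_single b (fun a _ hab => by rw [hother a hab, zero_mul])
    (fun h => by rw [notMem_support_iff.mp h, zero_mul])] at heval
  simpa using heval

/-- Every exponent of an element of the `k`-th power of the ideal of the coordinate point `e_j`
has total degree at least `k` in the variables other than `x_j`. -/
theorem le_sum_of_mem_coordIdeal4_pow {K : Type} [Field K] (j : Fin 4) (k : ℕ)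
    {f : MvPolynomial (Fin 4) K} (hf : f ∈ coordIdeal4 K j ^ k) {a : Fin 4 →₀ ℕ}
    (ha : coeff a f ≠ 0) : k ≤ ∑ i ∈ Finset.univ.erase j, a i := by
  induction k generalizing f a with
  | zero => exact Nat.zero_le _
  | succ k ih =>
    rw [pow_succ] at hf
    induction hf using Submodule.mul_induction_on' generalizing a with
    | mem_mul_mem g hg h hh =>
      rw [coeff_mul] at ha
      obtain ⟨⟨b, c⟩, hbc, hne⟩ := Finset.exists_ne_zero_of_sum_ne_zero ha
      rw [Finset.HasAntidiagonal.mem_antidiagonal] at hbc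
      have himage : coordIdeal4 K j = Ideal.span (X '' {i | i ≠ j}) := by
        rw [coordIdeal4]
        congr 1
        ext p
        simp [eq_comm]
      rw [himage, mem_ideal_span_X_image] at hh
      obtain ⟨i, hij, hi⟩ := hh c (mem_support_iff.mpr (right_ne_zero_of_mul hne))
      have h1 : k ≤ ∑ i ∈ Finset.univ.erase j, b i := ih hg (left_ne_zero_of_mul hne)
      have h2 : c i ≤ ∑ i ∈ Finset.univ.erase j, c i :=
        Finset.single_le_sum (fun _ _ => Nat.zero_le _)
          (Finset.mem_erase.mpr ⟨hij, Finset.mem_univ i⟩)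
      simp only [← hbc, Finsupp.add_apply, Finset.sum_add_distrib]
      omega
    | add g hg h hh ihg ihh =>
      rw [coeff_add] at ha
      by_cases h0 : coeff a g = 0
      · exact ihh (by simpa [h0] using ha)
      · exact ihg h0

/-- For the ideal `I` of the four coordinate points of `ℙ³` together with
`u = (1:1:1:1)`, the symbolic power `I^(3m)` contains no nonzero homogeneous
polynomial of degree `5m − 1`; equivalently `α(I^(3m)) ≥ 5m`. -/
theorem five_points_alpha_bound (K : Type) [Field K] [CharZero K] (m : ℕ) (hm : 1 ≤ m) :
    (∀ f ∈ (⨅ j : Fin 4, coordIdeal4 K j ^ (3 * m)) ⊓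
        pointIdeal K (fun _ => (1 : K)) ^ (3 * m),
      f.IsHomogeneous (5 * m - 1) → f = 0) ∧
    5 * m ≤ alphaDeg ((⨅ j : Fin 4, coordIdeal4 K j ^ (3 * m)) ⊓
      pointIdeal K (fun _ => (1 : K)) ^ (3 * m)) := by
  set J := (⨅ j : Fin 4, coordIdeal4 K j ^ (3 * m)) ⊓ pointIdeal K (fun _ => (1 : K)) ^ (3 * m)
  have hvanish : ∀ f ∈ J, f.IsHomogeneous (5 * m - 1) → f = 0 := by
    rintro f ⟨hcoord, hpoint⟩ hhom
    refine eq_zero_of_mem_pointIdeal_pow (N := 2 * m - 1) (by omega) hpoint hhom fun a ha j => ?_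
    have hle := le_sum_of_mem_coordIdeal4_pow j _ (Ideal.mem_iInf.mp hcoord j)
      (mem_support_iff.mp ha)
    have hdeg : ∑ i, a i = 5 * m - 1 := by
      rw [← Finsupp.degree_eq_sum, Finsupp.degree_eq_weight_one]
      exact hhom (mem_support_iff.mp ha)
    rw [← Finset.add_sum_erase _ _ (Finset.mem_univ j)] at hdeg
    omega
  refine ⟨hvanish, le_csInf ?_ ?_⟩
  · let w : MvPolynomial (Fin 4) K := X 0 * X 1 * (X 0 - X 1)
    have hw : w.IsHomogeneous (1 + 1 + 1) :=
      ((isHomogeneous_X K 0).mul (isHomogeneous_X K 1)).mul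
        ((isHomogeneous_X K 0).sub (isHomogeneous_X K 1))
    have hX (i j : Fin 4) (hij : i ≠ j) : (X i : MvPolynomial (Fin 4) K) ∈ coordIdeal4 K j :=
      Ideal.subset_span ⟨i, hij, rfl⟩
    refine ⟨_, w ^ (3 * m), ⟨Ideal.mem_iInf.mpr fun j => Ideal.pow_mem_pow ?_ _,
      Ideal.pow_mem_pow (Ideal.mul_mem_left _ _ (Ideal.subset_span ?_)) _⟩,
      pow_ne_zero _ ?_, hw.pow _⟩
    · by_cases h : (0 : Fin 4) = j
      · exact Ideal.mul_mem_right _ _ (Ideal.mul_mem_left _ _ (hX 1 j (by rw [← h]; decide)))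
      · exact Ideal.mul_mem_right _ _ (Ideal.mul_mem_right _ _ (hX 0 j h))
    · exact ⟨(isHomogeneous_X K 0).sub (isHomogeneous_X K 1), by simp⟩
    · refine mul_ne_zero (mul_ne_zero (X_ne_zero _) (X_ne_zero _)) (sub_ne_zero.mpr ?_)
      exact (X_injective (R := K)).ne (by decide)
  · rintro t ⟨f, hf, hne, hhom⟩
    by_contra! hlt
    have hmul := hvanish (f * X 0 ^ (5 * m - 1 - t)) (Ideal.mul_mem_right _ _ hf) (by
      have := hhom.mul (isHomogeneous_X_pow (R := K) (0 : Fin 4) (5 * m - 1 - t))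
      rwa [show t + (5 * m - 1 - t) = 5 * m - 1 by omega] at this)
    exact mul_ne_zero hne (pow_ne_zero _ (X_ne_zero _)) hmul

end
end

section
/- Let K be a field of characteristic zero. For every integer m ≥ 1 there exists a nonzero polynomial G in 24 variables over K such that for every tuple (v_1,…,v_6) of nonzero vectors in K^4 with G(v_1,…,v_6) ≠ 0, the fat points ideal ⋂_{j=1}^6 m_{v_j}^{7m} contains no nonzero homogeneous polynomial of degree 12m−1. Consequently, for 6 points in general position in P^3 one has α(I^{(7m)}) ≥ 12m, and the Waldschmidt constant satisfies γ(I) ≥ 12/7. -/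
open MvPolynomial Filter

noncomputable section

/-- A linear system whose coefficients are polynomials in some parameters and which has only the
trivial solution at one value of the parameters has only the trivial solution generically. -/
theorem exists_ne_zero_forall_eval_ne_zero {K τ ι S : Type*} [Field K] [Fintype S]
    (M : ι → S → MvPolynomial τ K) (w : τ → K)
    (h : ∀ c : S → K, (∀ i, ∑ s, eval w (M i s) * c s = 0) → c = 0) :
    ∃ G : MvPolynomial τ K, G ≠ 0 ∧ ∀ u : τ → K, eval u G ≠ 0 →
      ∀ c : S → K, (∀ i, ∑ s, eval u (M i s) * c s = 0) → c = 0 := by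
  classical
  have hspan : Submodule.span K (Set.range fun i s ↦ eval w (M i s)) = ⊤ := by
    by_contra hne
    obtain ⟨f, hf, hle⟩ := Submodule.exists_le_ker_of_lt_top _ (lt_top_iff_ne_top.2 hne)
    refine hf (LinearMap.pi_ext' fun s ↦ LinearMap.ext_ring ?_)
    refine congr_fun (h (fun s ↦ f (Pi.single s 1)) fun i ↦ ?_) s
    have hi : f (fun s ↦ eval w (M i s)) = 0 := hle (Submodule.subset_span ⟨i, rfl⟩)
    have hsingle (s : S) : (fun j ↦ if s = j then 1 else 0) = (Pi.single s 1 : S → K) :=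
      funext fun j ↦ by simp [Pi.single_apply, eq_comm]
    simpa only [LinearMap.pi_apply_eq_sum_univ f (fun s ↦ eval w (M i s)), smul_eq_mul,
      hsingle] using hi
  have hL (s : S) : ∃ L : ι →₀ K, L.sum (fun i a ↦ a • fun t ↦ eval w (M i t)) = Pi.single s 1 :=
    Finsupp.mem_span_range_iff_exists_finsupp.1 (hspan ▸ Submodule.mem_top)
  choose L hL using hL
  let N : Matrix S S (MvPolynomial τ K) := fun s t ↦ (L s).sum fun i a ↦ C a * M i t
  have hN (u : τ → K) (s t : S) : eval u (N s t) = (L s).sum fun i a ↦ a * eval u (M i t) := by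
    simp [N, Finsupp.sum]
  have hdet (u : τ → K) : eval u N.det = ((eval u).mapMatrix N).det := RingHom.map_det _ _
  refine ⟨N.det, fun h0 ↦ ?_, fun u hu c hc ↦ ?_⟩
  · have h1 : (eval w).mapMatrix N = 1 := by
      ext s t
      rw [RingHom.mapMatrix_apply, Matrix.map_apply, hN, Matrix.one_apply]
      have := congr_fun (hL s) t
      simpa [Finsupp.sum, Pi.single_apply, eq_comm] using this
    have := hdet w
    rw [h1, h0, Matrix.det_one, map_zero] at this
    exact zero_ne_one this
  · rw [hdet] at hu
    refine Matrix.eq_zero_of_mulVec_eq_zero hu (funext fun s ↦ ?_)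
    simp only [Matrix.mulVec, dotProduct, RingHom.mapMatrix_apply, Matrix.map_apply, hN,
      Finsupp.sum, Finset.sum_mul, Pi.zero_apply]
    rw [Finset.sum_comm]
    refine Finset.sum_eq_zero fun i _ ↦ ?_
    simp_rw [mul_assoc, ← Finset.mul_sum, hc i, mul_zero]

/-- The substitution `X i ↦ T * v i + X i`, with `T` the variable of the polynomial ring `A[T]`. -/
def homogeneousTaylor (K : Type*) {σ A : Type*} [CommRing K] [CommRing A] [Algebra K A]
    (v : σ → A) : MvPolynomial σ K →ₐ[K] MvPolynomial σ (Polynomial A) :=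
  aeval fun i ↦ C (Polynomial.X * Polynomial.C (v i)) + X i

theorem mapAlgHom_homogeneousTaylor {K σ A B : Type*} [CommRing K] [CommRing A] [CommRing B]
    [Algebra K A] [Algebra K B] (h : A →ₐ[K] B) (v : σ → A) (f : MvPolynomial σ K) :
    mapAlgHom (Polynomial.mapAlgHom h) (homogeneousTaylor K v f) =
      homogeneousTaylor K (fun i ↦ h (v i)) f := by
  rw [← AlgHom.comp_apply]
  congr 1
  ext i : 1
  simp [homogeneousTaylor]

theorem exists_ne_zero_forall_homogeneousTaylor {K σ ι : Type*} [Field K] [Fintype σ]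
    (d k : ℕ) (w : ι → σ → K)
    (h : ∀ f : MvPolynomial σ K, f.IsHomogeneous d →
      (∀ j, homogeneousTaylor K (w j) f ∈ idealOfVars σ (Polynomial K) ^ k) → f = 0) :
    ∃ G : MvPolynomial (ι × σ) K, G ≠ 0 ∧ ∀ v : ι → σ → K, eval (fun p ↦ v p.1 p.2) G ≠ 0 →
      ∀ f : MvPolynomial σ K, f.IsHomogeneous d →
        (∀ j, homogeneousTaylor K (v j) f ∈ idealOfVars σ (Polynomial K) ^ k) → f = 0 := by
  classical
  let S : Finset (σ →₀ ℕ) := Finset.finsuppAntidiag Finset.univ d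
  have hS (γ : σ →₀ ℕ) : γ ∈ S ↔ γ.degree = d := by
    simp [S, Finsupp.degree_eq_sum]
  let I := {p : ι × ℕ × (σ →₀ ℕ) // p.2.2.degree < k}
  let M : I → S → MvPolynomial (ι × σ) K := fun p γ ↦
    ((homogeneousTaylor K (fun i ↦ (X (p.1.1, i) : MvPolynomial (ι × σ) K))
      (monomial γ.1 1)).coeff p.1.2.2).coeff p.1.2.1
  have hM (v : ι → σ → K) (p : I) (γ : S) : eval (fun q ↦ v q.1 q.2) (M p γ) =
      ((homogeneousTaylor K (v p.1.1) (monomial γ.1 1)).coeff p.1.2.2).coeff p.1.2.1 := by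
    have := mapAlgHom_homogeneousTaylor (aeval fun q : ι × σ ↦ v q.1 q.2)
      (fun i ↦ (X (p.1.1, i) : MvPolynomial (ι × σ) K)) (monomial γ.1 1)
    simp only [aeval_X] at this
    rw [← this]
    simp [M, coeff_map]
  have hsum (v : ι → σ → K) (p : I) (c : S → K) :
      ∑ γ, eval (fun q ↦ v q.1 q.2) (M p γ) * c γ =
      ((homogeneousTaylor K (v p.1.1) (∑ γ : S, monomial γ.1 (c γ))).coeff p.1.2.2).coeff
        p.1.2.1 := by
    simp_rw [hM, map_sum, coeff_sum, Polynomial.finsetSum_coeff]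
    refine Finset.sum_congr rfl fun γ _ ↦ ?_
    have hγ : monomial γ.1 (c γ) = c γ • monomial γ.1 1 := by
      rw [smul_monomial, smul_eq_mul, mul_one]
    rw [hγ, map_smul, coeff_smul, Polynomial.coeff_smul, smul_eq_mul, mul_comm]
  have hrep {f : MvPolynomial σ K} (hf : f.IsHomogeneous d) :
      f = ∑ γ : S, monomial γ.1 (f.coeff γ.1) := by
    rw [Finset.sum_coe_sort S fun γ ↦ monomial γ (f.coeff γ)]
    conv_lhs => rw [f.as_sum]
    refine Finset.sum_subset (fun γ hγ ↦ (hS γ).2 ?_) fun γ _ hγ ↦ ?_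
    · by_contra hne
      exact (mem_support_iff.1 hγ) (hf.coeff_eq_zero hne)
    · rw [notMem_support_iff.1 hγ, monomial_zero]
  obtain ⟨G, hG, hGv⟩ := exists_ne_zero_forall_eval_ne_zero M (fun q ↦ w q.1 q.2) (by
    intro c hc
    have h0 : ∑ γ : S, monomial γ.1 (c γ) = 0 := by
      refine h _ (IsHomogeneous.sum _ _ _ fun γ _ ↦
        isHomogeneous_monomial _ ((hS _).1 γ.2)) fun j ↦ ?_
      refine (mem_pow_idealOfVars_iff' _ _).2 fun β hβ ↦ Polynomial.ext fun a ↦ ?_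
      have := hc ⟨(j, a, β), hβ⟩
      rwa [hsum] at this
    ext γ
    have := congr_arg (coeff γ.1) h0
    simpa [coeff_sum, coeff_monomial, Subtype.coe_inj] using this)
  refine ⟨G, hG, fun v hv f hf hfv ↦ ?_⟩
  have h0 := hGv _ hv (fun γ ↦ f.coeff γ.1) fun p ↦ by
    rw [hsum, ← hrep hf, (mem_pow_idealOfVars_iff' _ _).1 (hfv _) _ p.2, Polynomial.coeff_zero]
  rw [hrep hf]
  exact Finset.sum_eq_zero fun γ _ ↦ by rw [show f.coeff γ.1 = 0 from congr_fun h0 γ, monomial_zero]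

theorem homogeneousTaylor_sub_mem {K σ A : Type*} [CommRing K] [CommRing A] [Algebra K A]
    (v : σ → A) {f : MvPolynomial σ K} (hf : f.IsHomogeneous 1) :
    homogeneousTaylor K v f - C (Polynomial.X * Polynomial.C (aeval v f)) ∈
      idealOfVars σ (Polynomial A) := by
  rw [← mem_homogeneousSubmodule, homogeneousSubmodule_one_eq_span_X] at hf
  induction hf using Submodule.span_induction with
  | mem f hf =>
    obtain ⟨i, rfl⟩ := hf
    simpa [homogeneousTaylor] using Ideal.subset_span (Set.mem_range_self i)
  | zero => simp
  | add f g _ _ hf hg =>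
    convert add_mem hf hg using 1
    simp only [map_add, mul_add]
    ring
  | smul a f _ hf =>
    convert Submodule.smul_of_tower_mem _ a hf using 1
    rw [map_smul, map_smul, smul_sub, Algebra.smul_def a (C _), IsScalarTower.algebraMap_apply K
      (Polynomial A) (MvPolynomial σ (Polynomial A)), algebraMap_eq, ← C_mul,
      Polynomial.algebraMap_apply, Algebra.smul_def a (aeval v f), Polynomial.C_mul]
    congr 2
    ring

theorem homogeneousTaylor_mem_of_mem_pointIdeal_pow {K : Type} [Field K] (v : Fin 4 → K) {k : ℕ}
    {f : MvPolynomial (Fin 4) K} (hf : f ∈ pointIdeal K v ^ k) :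
    homogeneousTaylor K v f ∈ idealOfVars (Fin 4) (Polynomial K) ^ k := by
  have hle : (pointIdeal K v).map (homogeneousTaylor K v) ≤ idealOfVars (Fin 4) (Polynomial K) := by
    rw [pointIdeal, Ideal.map_span, Ideal.span_le]
    rintro _ ⟨f, ⟨hf, hfv⟩, rfl⟩
    have := homogeneousTaylor_sub_mem v hf
    rwa [aeval_eq_eval, hfv, Polynomial.C_0, mul_zero, C_0, sub_zero] at this
  have := Ideal.mem_map_of_mem (homogeneousTaylor K v) hf
  rw [Ideal.map_pow] at this
  exact Ideal.pow_right_mono hle k this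

theorem pow_dvd_aeval_of_homogeneousTaylor_mem {K σ R : Type*} [CommRing K] [CommRing R]
    [Algebra K R] (v : σ → K) {k : ℕ} {f : MvPolynomial σ K}
    (hf : homogeneousTaylor K v f ∈ idealOfVars σ (Polynomial K) ^ k) {g : σ → R} {q s : R}
    (h : ∀ i, q ∣ g i - algebraMap K R (v i) * s) : q ^ k ∣ aeval g f := by
  choose r hr using h
  let θ : MvPolynomial σ (Polynomial K) →+* R :=
    eval₂Hom (Polynomial.aeval s : Polynomial K →ₐ[K] R) fun i ↦ q * r i
  have hθ : θ (homogeneousTaylor K v f) = aeval g f := by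
    suffices θ.comp (homogeneousTaylor K v : MvPolynomial σ K →+* _) =
      (aeval g : MvPolynomial σ K →ₐ[K] R) from RingHom.congr_fun this f
    refine ringHom_ext (fun a ↦ ?_) fun i ↦ ?_
    · simp [θ, homogeneousTaylor, algHom_C, IsScalarTower.algebraMap_apply K
        (Polynomial K) (MvPolynomial σ (Polynomial K))]
    · simp [θ, homogeneousTaylor, ← hr]
  have hle : (idealOfVars σ (Polynomial K)).map θ ≤ Ideal.span {q} := by
    rw [idealOfVars, Ideal.map_span, Ideal.span_le]
    rintro _ ⟨_, ⟨i, rfl⟩, rfl⟩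
    simp [θ, Ideal.mem_span_singleton]
  have := Ideal.mem_map_of_mem θ hf
  rw [hθ, Ideal.map_pow] at this
  rw [← Ideal.mem_span_singleton, ← Ideal.span_singleton_pow]
  exact Ideal.pow_right_mono hle k this

theorem aeval_mul_left_of_isHomogeneous {K σ R : Type*} [CommRing K] [CommRing R] [Algebra K R]
    {f : MvPolynomial σ K} {d : ℕ} (hf : f.IsHomogeneous d) (c : R) (g : σ → R) :
    aeval (fun i ↦ c * g i) f = c ^ d * aeval g f := by
  simp only [aeval_def, eval₂_eq, Finset.mul_sum, mul_pow, Finset.prod_mul_distrib]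
  refine Finset.sum_congr rfl fun γ hγ ↦ ?_
  rw [Finset.prod_pow_eq_pow_sum, ← hf.degree_eq_sum_deg_support hγ]
  ring

theorem irreducible_of_linear_in_variable {K σ : Type*} [Field K] {i j k l : σ}
    (hij : i ≠ j) (hik : i ≠ k) (hil : i ≠ l) (hjk : j ≠ k) (hjl : j ≠ l)
    {a b c d e g : K} (ha : a ≠ 0) (y : σ → K) (hy : a * y j + b * y k + c * y l = 0)
    (hy' : d * y j * y k + e * y j * y l + g * y k * y l ≠ 0) :
    Irreducible ((C a * X j + C b * X k + C c * X l) * X i +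
      (C d * X j * X k + C e * X j * X l + C g * X k * X l) : MvPolynomial σ K) := by
  classical
  have hadd {i : σ} {p q : MvPolynomial σ K} (hp : i ∉ p.vars) (hq : i ∉ q.vars) :
      i ∉ (p + q).vars := fun h ↦ by simpa [hp, hq] using vars_add_subset p q h
  have hmul {i : σ} {p q : MvPolynomial σ K} (hp : i ∉ p.vars) (hq : i ∉ q.vars) :
      i ∉ (p * q).vars := fun h ↦ by simpa [hp, hq] using vars_mul p q h
  have hC {i : σ} (a : K) : i ∉ (C a : MvPolynomial σ K).vars := by simp
  have hX {i j : σ} (h : i ≠ j) : i ∉ (X j : MvPolynomial σ K).vars := by simpa using h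
  have hlin : Irreducible (C a * X j + C b * X k + C c * X l : MvPolynomial σ K) := by
    rw [add_assoc]
    exact irreducible_mul_X_add _ _ _ (C_ne_zero.2 ha) (hC a)
      (hadd (hmul (hC b) (hX hjk)) (hmul (hC c) (hX hjl)))
      ((isUnit_iff_ne_zero.2 ha).map C).isRelPrime_left
  refine irreducible_mul_X_add _ _ _ hlin.ne_zero
    (hadd (hadd (hmul (hC a) (hX hij)) (hmul (hC b) (hX hik))) (hmul (hC c) (hX hil)))
    (hadd (hadd (hmul (hmul (hC d) (hX hij)) (hX hik)) (hmul (hmul (hC e) (hX hij)) (hX hil)))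
      (hmul (hmul (hC g) (hX hik)) (hX hil))) (hlin.isRelPrime_iff_not_dvd.2 fun h ↦ hy' ?_)
  have := map_dvd (eval y) h
  simpa [hy] using this

section WeddleInvolution

variable (K : Type*) [Field K]

/-- The linear form with the given coefficients. -/
def linearForm (a b c d : K) : MvPolynomial (Fin 4) K :=
  C a * X 0 + C b * X 1 + C c * X 2 + C d * X 3

/-- The quadratic form without square terms with the given coefficients. -/
def squarefreeQuadric (a b c d e f : K) : MvPolynomial (Fin 4) K :=
  C a * X 0 * X 1 + C b * X 0 * X 2 + C c * X 0 * X 3 + C d * X 1 * X 2 + C e * X 1 * X 3 +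
    C f * X 2 * X 3

/-- Six points of `ℙ³` in linearly general position. -/
def sixPoints : Fin 6 → Fin 4 → K :=
  ![![1, 0, 0, 0], ![0, 1, 0, 0], ![0, 0, 1, 0], ![0, 0, 0, 1], ![1, 1, 1, 1], ![1, 2, 3, 4]]

/-- The quadric cone through all of the `sixPoints` with vertex at the given one of them. -/
def cone : Fin 6 → MvPolynomial (Fin 4) K :=
  ![squarefreeQuadric K 0 0 0 (-4) 6 (-2),
    squarefreeQuadric K 0 (-8) 9 0 0 (-1),
    squarefreeQuadric K (-4) 0 6 0 (-2) 0,
    squarefreeQuadric K (-3) 4 0 (-1) 0 0,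
    squarefreeQuadric K 1 (-4) 3 3 (-4) 1,
    squarefreeQuadric K 12 (-32) 18 12 (-12) 2]

/-- The plane through a coordinate point and the last two of the `sixPoints`. -/
def plane : Fin 4 → MvPolynomial (Fin 4) K :=
  ![linearForm K 0 (-1) 2 (-1),
    linearForm K (-1) 0 3 (-2),
    linearForm K (-2) 3 0 (-1),
    linearForm K (-1) 2 (-1) 0]

/-- The birational involution of `ℙ³` contracting each `cone` to its vertex: the covering
involution of the double cover given by the quadrics through the `sixPoints`. -/
def weddleInvolution : Fin 4 → MvPolynomial (Fin 4) K :=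
  ![plane K 0 * cone K 1 * cone K 2 * cone K 3,
    plane K 1 * cone K 0 * cone K 2 * cone K 3,
    plane K 2 * cone K 0 * cone K 1 * cone K 3,
    plane K 3 * cone K 0 * cone K 1 * cone K 2]

theorem isHomogeneous_linearForm (a b c d : K) : (linearForm K a b c d).IsHomogeneous 1 :=
  (((isHomogeneous_C_mul_X _ _).add (isHomogeneous_C_mul_X _ _)).add
    (isHomogeneous_C_mul_X _ _)).add (isHomogeneous_C_mul_X _ _)

theorem isHomogeneous_squarefreeQuadric (a b c d e f : K) :
    (squarefreeQuadric K a b c d e f).IsHomogeneous 2 := by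
  have h (r : K) (i j : Fin 4) : (C r * X i * X j).IsHomogeneous 2 :=
    (isHomogeneous_C_mul_X r i).mul (isHomogeneous_X K j)
  exact (((((h _ _ _).add (h _ _ _)).add (h _ _ _)).add (h _ _ _)).add (h _ _ _)).add (h _ _ _)

theorem isHomogeneous_cone (j : Fin 6) : (cone K j).IsHomogeneous 2 := by
  fin_cases j <;> exact isHomogeneous_squarefreeQuadric ..

theorem isHomogeneous_plane (i : Fin 4) : (plane K i).IsHomogeneous 1 := by
  fin_cases i <;> exact isHomogeneous_linearForm ..

theorem isHomogeneous_weddleInvolution (i : Fin 4) : (weddleInvolution K i).IsHomogeneous 7 := by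
  fin_cases i <;>
    exact (((isHomogeneous_plane K _).mul (isHomogeneous_cone K _)).mul
      (isHomogeneous_cone K _)).mul (isHomogeneous_cone K _)

theorem irreducible_cone [CharZero K] (j : Fin 6) : Irreducible (cone K j) := by
  fin_cases j
  · convert irreducible_of_linear_in_variable (K := K) (i := (1 : Fin 4)) (j := 2) (k := 3) (l := 0)
      (a := -4) (b := 6) (c := 0) (d := -2) (e := 0) (g := 0) (by decide) (by decide) (by decide)
      (by decide) (by decide) (by norm_num) ![0, 0, 3, 2] (by simp; norm_num) (by simp) using 1
    simp [cone, squarefreeQuadric]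
    ring
  · convert irreducible_of_linear_in_variable (K := K) (i := (0 : Fin 4)) (j := 2) (k := 3) (l := 1)
      (a := -8) (b := 9) (c := 0) (d := -1) (e := 0) (g := 0) (by decide) (by decide) (by decide)
      (by decide) (by decide) (by norm_num) ![0, 0, 9, 8] (by simp; norm_num) (by simp) using 1
    simp [cone, squarefreeQuadric]
    ring
  · convert irreducible_of_linear_in_variable (K := K) (i := (0 : Fin 4)) (j := 1) (k := 3) (l := 2)
      (a := -4) (b := 6) (c := 0) (d := -2) (e := 0) (g := 0) (by decide) (by decide) (by decide)
      (by decide) (by decide) (by norm_num) ![0, 3, 0, 2] (by simp; norm_num) (by simp) using 1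
    simp [cone, squarefreeQuadric]
    ring
  · convert irreducible_of_linear_in_variable (K := K) (i := (0 : Fin 4)) (j := 1) (k := 2) (l := 3)
      (a := -3) (b := 4) (c := 0) (d := -1) (e := 0) (g := 0) (by decide) (by decide) (by decide)
      (by decide) (by decide) (by norm_num) ![0, 4, 3, 0] (by simp; norm_num) (by simp) using 1
    simp [cone, squarefreeQuadric]
    ring
  · convert irreducible_of_linear_in_variable (K := K) (i := (0 : Fin 4)) (j := 1) (k := 2) (l := 3)
      (a := 1) (b := -4) (c := 3) (d := 3) (e := -4) (g := 1) (by decide) (by decide) (by decide)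
      (by decide) (by decide) (by norm_num) ![0, 4, 1, 0] (by simp) (by simp) using 1
    simp [cone, squarefreeQuadric]
    ring
  · convert irreducible_of_linear_in_variable (K := K) (i := (0 : Fin 4)) (j := 1) (k := 2) (l := 3)
      (a := 12) (b := -32) (c := 18) (d := 12) (e := -12) (g := 2) (by decide) (by decide)
      (by decide) (by decide) (by decide) (by norm_num) ![0, 8, 3, 0] (by simp; norm_num) (by simp)
      using 1
    simp [cone, squarefreeQuadric]
    ring

theorem mvPolynomial_C_ofNat (n : ℕ) [n.AtLeastTwo] :
    (C (ofNat(n) : K) : MvPolynomial (Fin 4) K) = ofNat(n) :=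
  map_ofNat C n

set_option maxHeartbeats 1000000 in
theorem not_cone_dvd_cone [CharZero K] {i j : Fin 6} (hij : i ≠ j) : ¬ cone K i ∣ cone K j := by
  let y : Fin 6 → Fin 4 → K := ![![0, 2, -2, -1], ![1, 0, -3, -2], ![2, -2, 0, -1],
    ![1, -2, -1, 0], ![1, 2, -1, 0], ![1, 1, 0, -2]]
  have hy : eval (y i) (cone K i) = 0 := by
    fin_cases i <;> simp [cone, squarefreeQuadric, y] <;> norm_num
  have hy' : eval (y i) (cone K j) ≠ 0 := by
    fin_cases i <;> fin_cases j <;> first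
      | exact absurd rfl hij
      | simp [cone, squarefreeQuadric, y] <;> norm_num
  intro h
  have := map_dvd (eval (y i)) h
  rw [hy, zero_dvd_iff] at this
  exact hy' this

theorem cone_four_dvd_weddleInvolution_sub (i : Fin 4) :
    cone K 4 ∣ weddleInvolution K i - weddleInvolution K 0 := by
  fin_cases i
  · simp
  · have h : plane K 1 * cone K 0 - plane K 0 * cone K 1 = cone K 4 * linearForm K 0 0 (-4) 3 := by
      simp only [plane, cone, linearForm, squarefreeQuadric, Matrix.cons_val, map_neg,
        mvPolynomial_C_ofNat, map_zero, map_one]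
      ring
    refine ⟨cone K 2 * cone K 3 * linearForm K 0 0 (-4) 3, ?_⟩
    change plane K 1 * cone K 0 * cone K 2 * cone K 3 -
        plane K 0 * cone K 1 * cone K 2 * cone K 3 = _
    linear_combination (cone K 2 * cone K 3) * h
  · have h : plane K 2 * cone K 0 - plane K 0 * cone K 2 = cone K 4 * linearForm K 0 (-4) 0 2 := by
      simp only [plane, cone, linearForm, squarefreeQuadric, Matrix.cons_val, map_neg,
        mvPolynomial_C_ofNat, map_zero, map_one]
      ring
    refine ⟨cone K 1 * cone K 3 * linearForm K 0 (-4) 0 2, ?_⟩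
    change plane K 2 * cone K 0 * cone K 1 * cone K 3 -
        plane K 0 * cone K 1 * cone K 2 * cone K 3 = _
    linear_combination (cone K 1 * cone K 3) * h
  · have h : plane K 3 * cone K 0 - plane K 0 * cone K 3 = cone K 4 * linearForm K 0 (-3) 2 0 := by
      simp only [plane, cone, linearForm, squarefreeQuadric, Matrix.cons_val, map_neg,
        mvPolynomial_C_ofNat, map_zero, map_one]
      ring
    refine ⟨cone K 1 * cone K 2 * linearForm K 0 (-3) 2 0, ?_⟩
    change plane K 3 * cone K 0 * cone K 1 * cone K 2 -
        plane K 0 * cone K 1 * cone K 2 * cone K 3 = _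
    linear_combination (cone K 1 * cone K 2) * h

theorem cone_five_dvd_weddleInvolution_sub (i : Fin 4) :
    cone K 5 ∣ weddleInvolution K i - C (sixPoints K 5 i) * weddleInvolution K 0 := by
  fin_cases i
  · simp [sixPoints]
  · have h : plane K 1 * cone K 0 - C 2 * plane K 0 * cone K 1 =
        cone K 5 * linearForm K 0 0 (-1) 1 := by
      simp only [plane, cone, linearForm, squarefreeQuadric, Matrix.cons_val, map_neg,
        mvPolynomial_C_ofNat, map_zero, map_one]
      ring
    refine ⟨cone K 2 * cone K 3 * linearForm K 0 0 (-1) 1, ?_⟩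
    change plane K 1 * cone K 0 * cone K 2 * cone K 3 -
      C 2 * (plane K 0 * cone K 1 * cone K 2 * cone K 3) = _
    linear_combination (cone K 2 * cone K 3) * h
  · have h : plane K 2 * cone K 0 - C 3 * plane K 0 * cone K 2 =
        cone K 5 * linearForm K 0 (-1) 0 1 := by
      simp only [plane, cone, linearForm, squarefreeQuadric, Matrix.cons_val, map_neg,
        mvPolynomial_C_ofNat, map_zero, map_one]
      ring
    refine ⟨cone K 1 * cone K 3 * linearForm K 0 (-1) 0 1, ?_⟩
    change plane K 2 * cone K 0 * cone K 1 * cone K 3 -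
      C 3 * (plane K 0 * cone K 1 * cone K 2 * cone K 3) = _
    linear_combination (cone K 1 * cone K 3) * h
  · have h : plane K 3 * cone K 0 - C 4 * plane K 0 * cone K 3 =
        cone K 5 * linearForm K 0 (-1) 1 0 := by
      simp only [plane, cone, linearForm, squarefreeQuadric, Matrix.cons_val, map_neg,
        mvPolynomial_C_ofNat, map_zero, map_one]
      ring
    refine ⟨cone K 1 * cone K 2 * linearForm K 0 (-1) 1 0, ?_⟩
    change plane K 3 * cone K 0 * cone K 1 * cone K 2 -
      C 4 * (plane K 0 * cone K 1 * cone K 2 * cone K 3) = _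
    linear_combination (cone K 1 * cone K 2) * h

theorem dvd_vecCons_mul {R : Type*} [CommRing R] (p c : Fin 4 → R) {i j : Fin 4} (h : i ≠ j) :
    c j ∣ ![p 0 * c 1 * c 2 * c 3, p 1 * c 0 * c 2 * c 3, p 2 * c 0 * c 1 * c 3,
      p 3 * c 0 * c 1 * c 2] i := by
  fin_cases i <;> fin_cases j <;> first
    | exact absurd rfl h
    | exact dvd_mul_left _ _
    | exact (dvd_mul_left _ _).mul_right _
    | exact ((dvd_mul_left _ _).mul_right _).mul_right _

theorem exists_cone_dvd_weddleInvolution_sub (j : Fin 6) :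
    ∃ s, ∀ i, cone K j ∣ weddleInvolution K i - C (sixPoints K j i) * s := by
  have h (j : Fin 4) : ∃ s, ∀ i, cone K (j.castLE (by simp)) ∣
      weddleInvolution K i - C (sixPoints K (j.castLE (by simp)) i) * s := by
    refine ⟨weddleInvolution K j, fun i ↦ ?_⟩
    rcases eq_or_ne i j with rfl | hij
    · convert dvd_zero _
      fin_cases i <;> simp [sixPoints]
    · have h0 : sixPoints K (j.castLE (by simp)) i = 0 := by
        fin_cases i <;> fin_cases j <;> first | exact absurd rfl hij | rfl
      rw [h0, C_0, zero_mul, sub_zero]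
      exact dvd_vecCons_mul (plane K) (fun j ↦ cone K (j.castLE (by simp))) hij
  fin_cases j
  · exact h 0
  · exact h 1
  · exact h 2
  · exact h 3
  · refine ⟨weddleInvolution K 0, fun i ↦ ?_⟩
    have h1 : sixPoints K 4 i = 1 := by fin_cases i <;> rfl
    change cone K 4 ∣ weddleInvolution K i - C (sixPoints K 4 i) * weddleInvolution K 0
    rw [h1, C_1, one_mul]
    exact cone_four_dvd_weddleInvolution_sub K i
  · exact ⟨weddleInvolution K 0, cone_five_dvd_weddleInvolution_sub K⟩

theorem aeval_linearForm (g : Fin 4 → MvPolynomial (Fin 4) K) (a b c d : K) :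
    aeval g (linearForm K a b c d) = C a * g 0 + C b * g 1 + C c * g 2 + C d * g 3 := by
  simp [linearForm, algHom_C]

theorem aeval_squarefreeQuadric (g : Fin 4 → MvPolynomial (Fin 4) K) (a b c d e f : K) :
    aeval g (squarefreeQuadric K a b c d e f) = C a * g 0 * g 1 + C b * g 0 * g 2 +
      C c * g 0 * g 3 + C d * g 1 * g 2 + C e * g 1 * g 3 + C f * g 2 * g 3 := by
  simp [squarefreeQuadric, algHom_C]

theorem aeval_weddleInvolution_plane (i : Fin 4) : aeval (weddleInvolution K) (plane K i) =
    X i * cone K (i.castLE (by simp)) * cone K 4 * cone K 5 := by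
  fin_cases i
  · have h : -plane K 1 * cone K 2 * cone K 3 + 2 * plane K 2 * cone K 1 * cone K 3 -
      plane K 3 * cone K 1 * cone K 2 =
        X 0 * cone K 4 * cone K 5 := by
      simp only [plane, cone, linearForm, squarefreeQuadric, Matrix.cons_val, map_neg,
        mvPolynomial_C_ofNat, map_zero, map_one]
      ring
    refine (aeval_linearForm K _ _ _ _ _).trans ?_
    change C (0) * (plane K 0 * cone K 1 * cone K 2 * cone K 3) +
      C (-1) * (plane K 1 * cone K 0 * cone K 2 * cone K 3) +
      C (2) * (plane K 2 * cone K 0 * cone K 1 * cone K 3) +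
      C (-1) * (plane K 3 * cone K 0 * cone K 1 * cone K 2) =
      X 0 * cone K 0 * cone K 4 * cone K 5
    simp only [map_neg, mvPolynomial_C_ofNat, map_zero, map_one]
    linear_combination cone K 0 * h
  · have h : -plane K 0 * cone K 2 * cone K 3 + 3 * plane K 2 * cone K 0 * cone K 3 -
      2 * plane K 3 * cone K 0 * cone K 2 =
        X 1 * cone K 4 * cone K 5 := by
      simp only [plane, cone, linearForm, squarefreeQuadric, Matrix.cons_val, map_neg,
        mvPolynomial_C_ofNat, map_zero, map_one]
      ring
    refine (aeval_linearForm K _ _ _ _ _).trans ?_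
    change C (-1) * (plane K 0 * cone K 1 * cone K 2 * cone K 3) +
      C (0) * (plane K 1 * cone K 0 * cone K 2 * cone K 3) +
      C (3) * (plane K 2 * cone K 0 * cone K 1 * cone K 3) +
      C (-2) * (plane K 3 * cone K 0 * cone K 1 * cone K 2) =
      X 1 * cone K 1 * cone K 4 * cone K 5
    simp only [map_neg, mvPolynomial_C_ofNat, map_zero, map_one]
    linear_combination cone K 1 * h
  · have h : -2 * plane K 0 * cone K 1 * cone K 3 + 3 * plane K 1 * cone K 0 * cone K 3 -
      plane K 3 * cone K 0 * cone K 1 =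
        X 2 * cone K 4 * cone K 5 := by
      simp only [plane, cone, linearForm, squarefreeQuadric, Matrix.cons_val, map_neg,
        mvPolynomial_C_ofNat, map_zero, map_one]
      ring
    refine (aeval_linearForm K _ _ _ _ _).trans ?_
    change C (-2) * (plane K 0 * cone K 1 * cone K 2 * cone K 3) +
      C (3) * (plane K 1 * cone K 0 * cone K 2 * cone K 3) +
      C (0) * (plane K 2 * cone K 0 * cone K 1 * cone K 3) +
      C (-1) * (plane K 3 * cone K 0 * cone K 1 * cone K 2) =
      X 2 * cone K 2 * cone K 4 * cone K 5
    simp only [map_neg, mvPolynomial_C_ofNat, map_zero, map_one]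
    linear_combination cone K 2 * h
  · have h : -plane K 0 * cone K 1 * cone K 2 + 2 * plane K 1 * cone K 0 * cone K 2 -
      plane K 2 * cone K 0 * cone K 1 =
        X 3 * cone K 4 * cone K 5 := by
      simp only [plane, cone, linearForm, squarefreeQuadric, Matrix.cons_val, map_neg,
        mvPolynomial_C_ofNat, map_zero, map_one]
      ring
    refine (aeval_linearForm K _ _ _ _ _).trans ?_
    change C (-1) * (plane K 0 * cone K 1 * cone K 2 * cone K 3) +
      C (2) * (plane K 1 * cone K 0 * cone K 2 * cone K 3) +
      C (-1) * (plane K 2 * cone K 0 * cone K 1 * cone K 3) +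
      C (0) * (plane K 3 * cone K 0 * cone K 1 * cone K 2) =
      X 3 * cone K 3 * cone K 4 * cone K 5
    simp only [map_neg, mvPolynomial_C_ofNat, map_zero, map_one]
    linear_combination cone K 3 * h

theorem aeval_weddleInvolution_cone (i : Fin 4) :
    aeval (weddleInvolution K) (cone K (i.castLE (by simp))) =
      (∏ j, cone K j) * cone K (i.castLE (by simp)) := by
  rw [Fin.prod_univ_six]
  fin_cases i
  · have h : -4 * plane K 1 * plane K 2 * cone K 3 + 6 * plane K 1 * plane K 3 * cone K 2 -
      2 * plane K 2 * plane K 3 * cone K 1 =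
        cone K 4 * cone K 5 := by
      simp only [plane, cone, linearForm, squarefreeQuadric, Matrix.cons_val, map_neg,
        mvPolynomial_C_ofNat, map_zero, map_one]
      ring
    refine (aeval_squarefreeQuadric K _ _ _ _ _ _ _).trans ?_
    change C (0) * (plane K 0 * cone K 1 * cone K 2 * cone K 3) *
        (plane K 1 * cone K 0 * cone K 2 * cone K 3) +
      C (0) * (plane K 0 * cone K 1 * cone K 2 * cone K 3) *
        (plane K 2 * cone K 0 * cone K 1 * cone K 3) +
      C (0) * (plane K 0 * cone K 1 * cone K 2 * cone K 3) *
        (plane K 3 * cone K 0 * cone K 1 * cone K 2) +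
      C (-4) * (plane K 1 * cone K 0 * cone K 2 * cone K 3) *
        (plane K 2 * cone K 0 * cone K 1 * cone K 3) +
      C (6) * (plane K 1 * cone K 0 * cone K 2 * cone K 3) *
        (plane K 3 * cone K 0 * cone K 1 * cone K 2) +
      C (-2) * (plane K 2 * cone K 0 * cone K 1 * cone K 3) *
        (plane K 3 * cone K 0 * cone K 1 * cone K 2) =
      cone K 0 * cone K 1 * cone K 2 * cone K 3 * cone K 4 * cone K 5 * cone K 0
    simp only [map_neg, mvPolynomial_C_ofNat, map_zero]
    linear_combination cone K 0 * cone K 0 * cone K 1 * cone K 2 * cone K 3 * h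
  · have h : -8 * plane K 0 * plane K 2 * cone K 3 + 9 * plane K 0 * plane K 3 * cone K 2 -
      plane K 2 * plane K 3 * cone K 0 =
        cone K 4 * cone K 5 := by
      simp only [plane, cone, linearForm, squarefreeQuadric, Matrix.cons_val, map_neg,
        mvPolynomial_C_ofNat, map_zero, map_one]
      ring
    refine (aeval_squarefreeQuadric K _ _ _ _ _ _ _).trans ?_
    change C (0) * (plane K 0 * cone K 1 * cone K 2 * cone K 3) *
        (plane K 1 * cone K 0 * cone K 2 * cone K 3) +
      C (-8) * (plane K 0 * cone K 1 * cone K 2 * cone K 3) *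
        (plane K 2 * cone K 0 * cone K 1 * cone K 3) +
      C (9) * (plane K 0 * cone K 1 * cone K 2 * cone K 3) *
        (plane K 3 * cone K 0 * cone K 1 * cone K 2) +
      C (0) * (plane K 1 * cone K 0 * cone K 2 * cone K 3) *
        (plane K 2 * cone K 0 * cone K 1 * cone K 3) +
      C (0) * (plane K 1 * cone K 0 * cone K 2 * cone K 3) *
        (plane K 3 * cone K 0 * cone K 1 * cone K 2) +
      C (-1) * (plane K 2 * cone K 0 * cone K 1 * cone K 3) *
        (plane K 3 * cone K 0 * cone K 1 * cone K 2) =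
      cone K 0 * cone K 1 * cone K 2 * cone K 3 * cone K 4 * cone K 5 * cone K 1
    simp only [map_neg, mvPolynomial_C_ofNat, map_zero, map_one]
    linear_combination cone K 1 * cone K 0 * cone K 1 * cone K 2 * cone K 3 * h
  · have h : -4 * plane K 0 * plane K 1 * cone K 3 + 6 * plane K 0 * plane K 3 * cone K 1 -
      2 * plane K 1 * plane K 3 * cone K 0 =
        cone K 4 * cone K 5 := by
      simp only [plane, cone, linearForm, squarefreeQuadric, Matrix.cons_val, map_neg,
        mvPolynomial_C_ofNat, map_zero, map_one]
      ring
    refine (aeval_squarefreeQuadric K _ _ _ _ _ _ _).trans ?_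
    change C (-4) * (plane K 0 * cone K 1 * cone K 2 * cone K 3) *
        (plane K 1 * cone K 0 * cone K 2 * cone K 3) +
      C (0) * (plane K 0 * cone K 1 * cone K 2 * cone K 3) *
        (plane K 2 * cone K 0 * cone K 1 * cone K 3) +
      C (6) * (plane K 0 * cone K 1 * cone K 2 * cone K 3) *
        (plane K 3 * cone K 0 * cone K 1 * cone K 2) +
      C (0) * (plane K 1 * cone K 0 * cone K 2 * cone K 3) *
        (plane K 2 * cone K 0 * cone K 1 * cone K 3) +
      C (-2) * (plane K 1 * cone K 0 * cone K 2 * cone K 3) *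
        (plane K 3 * cone K 0 * cone K 1 * cone K 2) +
      C (0) * (plane K 2 * cone K 0 * cone K 1 * cone K 3) *
        (plane K 3 * cone K 0 * cone K 1 * cone K 2) =
      cone K 0 * cone K 1 * cone K 2 * cone K 3 * cone K 4 * cone K 5 * cone K 2
    simp only [map_neg, mvPolynomial_C_ofNat, map_zero]
    linear_combination cone K 2 * cone K 0 * cone K 1 * cone K 2 * cone K 3 * h
  · have h : -3 * plane K 0 * plane K 1 * cone K 2 + 4 * plane K 0 * plane K 2 * cone K 1 -
      plane K 1 * plane K 2 * cone K 0 =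
        cone K 4 * cone K 5 := by
      simp only [plane, cone, linearForm, squarefreeQuadric, Matrix.cons_val, map_neg,
        mvPolynomial_C_ofNat, map_zero, map_one]
      ring
    refine (aeval_squarefreeQuadric K _ _ _ _ _ _ _).trans ?_
    change C (-3) * (plane K 0 * cone K 1 * cone K 2 * cone K 3) *
        (plane K 1 * cone K 0 * cone K 2 * cone K 3) +
      C (4) * (plane K 0 * cone K 1 * cone K 2 * cone K 3) *
        (plane K 2 * cone K 0 * cone K 1 * cone K 3) +
      C (0) * (plane K 0 * cone K 1 * cone K 2 * cone K 3) *
        (plane K 3 * cone K 0 * cone K 1 * cone K 2) +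
      C (-1) * (plane K 1 * cone K 0 * cone K 2 * cone K 3) *
        (plane K 2 * cone K 0 * cone K 1 * cone K 3) +
      C (0) * (plane K 1 * cone K 0 * cone K 2 * cone K 3) *
        (plane K 3 * cone K 0 * cone K 1 * cone K 2) +
      C (0) * (plane K 2 * cone K 0 * cone K 1 * cone K 3) *
        (plane K 3 * cone K 0 * cone K 1 * cone K 2) =
      cone K 0 * cone K 1 * cone K 2 * cone K 3 * cone K 4 * cone K 5 * cone K 3
    simp only [map_neg, mvPolynomial_C_ofNat, map_zero, map_one]
    linear_combination cone K 3 * cone K 0 * cone K 1 * cone K 2 * cone K 3 * h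

/-- Up to a common factor, `weddleInvolution` is an involution. -/
theorem aeval_weddleInvolution_weddleInvolution (i : Fin 4) :
    aeval (weddleInvolution K) (weddleInvolution K i) = (∏ j, cone K j) ^ 4 * X i := by
  have hN := Fin.prod_univ_six (cone K)
  have hc0 : aeval (weddleInvolution K) (cone K 0) = (∏ j, cone K j) * cone K 0 :=
    aeval_weddleInvolution_cone K 0
  have hc1 : aeval (weddleInvolution K) (cone K 1) = (∏ j, cone K j) * cone K 1 :=
    aeval_weddleInvolution_cone K 1
  have hc2 : aeval (weddleInvolution K) (cone K 2) = (∏ j, cone K j) * cone K 2 :=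
    aeval_weddleInvolution_cone K 2
  have hc3 : aeval (weddleInvolution K) (cone K 3) = (∏ j, cone K j) * cone K 3 :=
    aeval_weddleInvolution_cone K 3
  have hp := aeval_weddleInvolution_plane K i
  generalize (∏ j, cone K j) = N at *
  fin_cases i
  · have h : aeval (weddleInvolution K) (plane K 0) = X 0 * cone K 0 * cone K 4 * cone K 5 := hp
    change aeval _ (plane K 0 * cone K 1 * cone K 2 * cone K 3) = N ^ 4 * X 0
    rw [map_mul, map_mul, map_mul, h, hc1, hc2, hc3]
    linear_combination -N ^ 3 * X 0 * hN
  · have h : aeval (weddleInvolution K) (plane K 1) = X 1 * cone K 1 * cone K 4 * cone K 5 := hp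
    change aeval _ (plane K 1 * cone K 0 * cone K 2 * cone K 3) = N ^ 4 * X 1
    rw [map_mul, map_mul, map_mul, h, hc0, hc2, hc3]
    linear_combination -N ^ 3 * X 1 * hN
  · have h : aeval (weddleInvolution K) (plane K 2) = X 2 * cone K 2 * cone K 4 * cone K 5 := hp
    change aeval _ (plane K 2 * cone K 0 * cone K 1 * cone K 3) = N ^ 4 * X 2
    rw [map_mul, map_mul, map_mul, h, hc0, hc1, hc3]
    linear_combination -N ^ 3 * X 2 * hN
  · have h : aeval (weddleInvolution K) (plane K 3) = X 3 * cone K 3 * cone K 4 * cone K 5 := hp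
    change aeval _ (plane K 3 * cone K 0 * cone K 1 * cone K 2) = N ^ 4 * X 3
    rw [map_mul, map_mul, map_mul, h, hc0, hc1, hc2]
    linear_combination -N ^ 3 * X 3 * hN

end WeddleInvolution

/-- A form of degree `12 m - 1` vanishes if it has multiplicity `7 m` at the `sixPoints`. -/
theorem eq_zero_of_homogeneousTaylor_sixPoints_mem {K : Type*} [Field K] [CharZero K] {m : ℕ}
    (hm : 1 ≤ m) {f : MvPolynomial (Fin 4) K} (hf : f.IsHomogeneous (12 * m - 1))
    (h : ∀ j, homogeneousTaylor K (sixPoints K j) f ∈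
      idealOfVars (Fin 4) (Polynomial K) ^ (7 * m)) : f = 0 := by
  have hdvd (j : Fin 6) : cone K j ^ (7 * m) ∣ aeval (weddleInvolution K) f := by
    obtain ⟨s, hs⟩ := exists_cone_dvd_weddleInvolution_sub K j
    exact pow_dvd_aeval_of_homogeneousTaylor_mem (sixPoints K j) (h j) hs
  have hprod : ∏ j, cone K j ^ (7 * m) ∣ aeval (weddleInvolution K) f :=
    Finset.prod_dvd_of_isRelPrime (fun i _ j _ hij ↦
      ((irreducible_cone K i).isRelPrime_iff_not_dvd.2 (not_cone_dvd_cone K hij)).pow)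
      fun j _ ↦ hdvd j
  have hcone : ∏ j, cone K j ≠ 0 :=
    Finset.prod_ne_zero_iff.2 fun j _ ↦ (irreducible_cone K j).ne_zero
  have hzero : aeval (weddleInvolution K) f = 0 := by
    by_contra hne
    have hle := totalDegree_le_of_dvd_of_isDomain hprod hne
    rw [((IsHomogeneous.prod _ _ _ fun j _ ↦ (isHomogeneous_cone K j).pow (7 * m))).totalDegree
      (Finset.prod_pow Finset.univ (7 * m) (cone K) ▸ pow_ne_zero _ hcone),
      (hf.aeval _ (isHomogeneous_weddleInvolution K)).totalDegree hne] at hle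
    simp only [Finset.sum_const, Finset.card_univ, Fintype.card_fin, smul_eq_mul] at hle
    omega
  have hcomp : aeval (weddleInvolution K) (aeval (weddleInvolution K) f) =
      ((∏ j, cone K j) ^ 4) ^ (12 * m - 1) * f := by
    rw [← AlgHom.comp_apply, comp_aeval]
    simp only [aeval_weddleInvolution_weddleInvolution]
    rw [aeval_mul_left_of_isHomogeneous hf, aeval_X_left_apply]
  rw [hzero, map_zero] at hcomp
  exact (mul_eq_zero.1 hcomp.symm).resolve_left (pow_ne_zero _ (pow_ne_zero _ hcone))

theorem exists_mem_pointIdeal {K : Type} [Field K] (v : Fin 4 → K) :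
    ∃ l ∈ pointIdeal K v, l ≠ 0 ∧ l.IsHomogeneous 1 := by
  suffices ∃ l : MvPolynomial (Fin 4) K, l ≠ 0 ∧ l.IsHomogeneous 1 ∧ eval v l = 0 by
    obtain ⟨l, h0, h1, hv⟩ := this
    exact ⟨l, Ideal.subset_span ⟨h1, hv⟩, h0, h1⟩
  by_cases h : v 0 = 0
  · exact ⟨X 0, X_ne_zero 0, isHomogeneous_X K 0, by simp [h]⟩
  · refine ⟨C (v 1) * X 0 - C (v 0) * X 1, fun hl ↦ h ?_,
      (isHomogeneous_C_mul_X _ _).sub (isHomogeneous_C_mul_X _ _), by simp [mul_comm]⟩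
    simpa using congrArg (eval ![0, 1, 0, 0]) hl

theorem exists_mem_iInf_pointIdeal_pow {K ι : Type} [Field K] [Fintype ι] (v : ι → Fin 4 → K)
    (k : ℕ) : ∃ t, ∃ f ∈ ⨅ j, pointIdeal K (v j) ^ k, f ≠ 0 ∧ f.IsHomogeneous t := by
  choose l hl hl0 hl1 using fun j ↦ exists_mem_pointIdeal (v j)
  refine ⟨_, ∏ j, l j ^ k, Ideal.mem_iInf.2 fun j ↦ ?_,
    Finset.prod_ne_zero_iff.2 fun j _ ↦ pow_ne_zero k (hl0 j),
    IsHomogeneous.prod _ _ _ fun j _ ↦ (hl1 j).pow k⟩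
  exact Ideal.mem_of_dvd _ (Finset.dvd_prod_of_mem _ (Finset.mem_univ j))
    (Ideal.pow_mem_pow (hl j) k)

theorem le_alphaDeg {K σ : Type} [Field K] [Nonempty σ] {J : Ideal (MvPolynomial σ K)} {n : ℕ}
    (hn : 1 ≤ n) (hJ : ∃ t, ∃ f ∈ J, f ≠ 0 ∧ f.IsHomogeneous t)
    (h : ∀ f ∈ J, f.IsHomogeneous (n - 1) → f = 0) : n ≤ alphaDeg J := by
  refine le_csInf hJ ?_
  rintro t ⟨f, hfJ, hf0, hft⟩
  by_contra! hlt
  let i := Classical.arbitrary σ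
  have hX : (X i : MvPolynomial σ K) ^ (n - 1 - t) ≠ 0 := pow_ne_zero _ (X_ne_zero i)
  refine mul_ne_zero hX hf0 (h _ (J.mul_mem_left _ hfJ) ?_)
  convert (isHomogeneous_X_pow i (n - 1 - t)).mul hft using 1
  omega

/-- For 6 points in general position in `ℙ³`: `I^(7m)` has no nonzero form of degree
`12m − 1`, hence `α(I^(7m)) ≥ 12m`, and consequently the Waldschmidt constant
satisfies `γ(I) ≥ 12/7`. -/
theorem six_points_waldschmidt (K : Type) [Field K] [CharZero K] :
    (∀ m : ℕ, 1 ≤ m →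
      ∃ G : MvPolynomial (Fin 6 × Fin 4) K, G ≠ 0 ∧
        ∀ v : Fin 6 → Fin 4 → K, (∀ j, v j ≠ 0) →
          eval (fun p => v p.1 p.2) G ≠ 0 →
          (∀ f ∈ ⨅ j, pointIdeal K (v j) ^ (7 * m),
            f.IsHomogeneous (12 * m - 1) → f = 0) ∧
          12 * m ≤ alphaDeg (⨅ j, pointIdeal K (v j) ^ (7 * m))) ∧
    (∀ v : Fin 6 → Fin 4 → K, (∀ j, v j ≠ 0) →
      (∀ m : ℕ, 1 ≤ m → 12 * m ≤ alphaDeg (⨅ j, pointIdeal K (v j) ^ (7 * m))) →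
      ∀ γ : ℝ,
        Tendsto (fun k : ℕ => (alphaDeg (⨅ j, pointIdeal K (v j) ^ k) : ℝ) / k)
          atTop (nhds γ) →
        12 / 7 ≤ γ) := by
  refine ⟨fun m hm ↦ ?_, fun v _ hα γ hγ ↦ ?_⟩
  · obtain ⟨G, hG, h⟩ := exists_ne_zero_forall_homogeneousTaylor (12 * m - 1) (7 * m)
      (sixPoints K) fun f hf hT ↦ eq_zero_of_homogeneousTaylor_sixPoints_mem hm hf hT
    refine ⟨G, hG, fun v _ hv ↦ ?_⟩
    have key (f) (hfJ : f ∈ ⨅ j, pointIdeal K (v j) ^ (7 * m))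
        (hf : f.IsHomogeneous (12 * m - 1)) : f = 0 :=
      h v hv f hf fun j ↦
        homogeneousTaylor_mem_of_mem_pointIdeal_pow (v j) (Ideal.mem_iInf.1 hfJ j)
    exact ⟨key, le_alphaDeg (by omega) (exists_mem_iInf_pointIdeal_pow v (7 * m)) key⟩
  · have hsub : Tendsto (fun m : ℕ ↦ 7 * m) atTop atTop :=
      tendsto_id.const_mul_atTop' (by norm_num)
    refine ge_of_tendsto (hγ.comp hsub) ?_
    filter_upwards [eventually_ge_atTop 1] with m hm
    have h12 : (12 * m : ℝ) ≤ alphaDeg (⨅ j, pointIdeal K (v j) ^ (7 * m)) := by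
      exact_mod_cast hα m hm
    have hm' : (0 : ℝ) < m := by exact_mod_cast hm
    simp only [Function.comp_apply, Nat.cast_mul, Nat.cast_ofNat]
    rw [div_le_div_iff₀ (by norm_num) (by positivity)]
    linarith

end
end

section
/- Let K be a field of characteristic zero and let b ≥ 1, m ≥ 1, t ≥ 0 be integers. Suppose there exists a nonzero polynomial G in 4b variables over K such that for every tuple (v_1,…,v_b) of nonzero vectors in K^4 with G(v_1,…,v_b) ≠ 0, the ideal ⋂_{j=1}^b m_{v_j}^{2m} contains no nonzero homogeneous polynomial of degree t. Then there exists a nonzero polynomial H in 32b variables over K such that for every tuple (w_1,…,w_{8b}) of nonzero vectors in K^4 with H(w_1,…,w_{8b}) ≠ 0, the ideal ⋂_{j=1}^{8b} m_{w_j}^{m} contains no nonzero homogeneous polynomial of degree t. In particular, for points in general position in P^3, α of the ideal of 8b points each with multiplicity m is at least α of the ideal of b points each with multiplicity 2m, and hence γ(8b points) ≥ 2·γ(b points). -/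
open MvPolynomial Filter

noncomputable section

/-! ### Translations of polynomials and vanishing on a cube -/

section Cube

variable {σ K : Type*} [Field K]

/-- The substitution `X ↦ X + u`. -/
def translateBy (u : σ → K) : MvPolynomial σ K →ₐ[K] MvPolynomial σ K :=
  aeval fun i => X i + C (u i)

/-- The substitution of the constants `c i` for the variables `X i` with `i ∉ S`. -/
def restrictTo [DecidableEq σ] (S : Finset σ) (c : σ → K) :
    MvPolynomial σ K →ₐ[K] MvPolynomial σ K :=
  aeval fun i => if i ∈ S then X i else C (c i)

lemma totalDegree_aeval_le {g : σ → MvPolynomial σ K} (hg : ∀ i, (g i).totalDegree ≤ 1)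
    (f : MvPolynomial σ K) : (aeval g f).totalDegree ≤ f.totalDegree := by
  rw [aeval_def, eval₂_eq]
  refine totalDegree_finsetSum_le fun d hd => ?_
  calc (algebraMap K (MvPolynomial σ K) (coeff d f) * ∏ i ∈ d.support, g i ^ d i).totalDegree
      ≤ (C (coeff d f) : MvPolynomial σ K).totalDegree
          + (∏ i ∈ d.support, g i ^ d i).totalDegree := totalDegree_mul _ _
    _ ≤ 0 + ∑ i ∈ d.support, (g i ^ d i).totalDegree := by
        rw [totalDegree_C]
        gcongr
        exact totalDegree_finsetProd _ _
    _ ≤ ∑ i ∈ d.support, d i := by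
        rw [zero_add]
        refine Finset.sum_le_sum fun i _ => (totalDegree_pow _ _).trans ?_
        simpa using Nat.mul_le_mul_left (d i) (hg i)
    _ ≤ f.totalDegree := le_totalDegree hd

lemma X_sub_C_dvd_of_aeval_update_eq_zero [DecidableEq σ] {i : σ} {a : K} {f : MvPolynomial σ K}
    (h : aeval (Function.update X i (C a)) f = (0 : MvPolynomial σ K)) : X i - C a ∣ f := by
  rw [← Ideal.mem_span_singleton, ← Ideal.Quotient.eq_zero_iff_mem]
  set q := Ideal.Quotient.mkₐ K (Ideal.span {(X i - C a : MvPolynomial σ K)})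
  have hq : q.comp (aeval (Function.update X i (C a))) = q := by
    ext j
    rcases eq_or_ne j i with rfl | hj
    · simp only [AlgHom.comp_apply, aeval_X, Function.update_self]
      exact ((Ideal.Quotient.eq).2 (Ideal.mem_span_singleton_self _)).symm
    · simp [hj]
  have := congrArg (fun φ => φ f) hq
  simp only [AlgHom.comp_apply, h, map_zero] at this
  exact this.symm

lemma idealOfVars_pow_of_X_mul_mem {i : σ} {m : ℕ} {f : MvPolynomial σ K}
    (h : X i * f ∈ idealOfVars σ K ^ (m + 1)) : f ∈ idealOfVars σ K ^ m := by
  rw [mem_pow_idealOfVars_iff'] at h ⊢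
  intro x hx
  have := h (Finsupp.single i 1 + x) (by simp; omega)
  rwa [coeff_X_mul] at this

lemma idealOfVars_pow_of_X_add_C_mul_mem {i : σ} {a : K} (ha : a ≠ 0) {m : ℕ}
    {f : MvPolynomial σ K} (h : (X i + C a) * f ∈ idealOfVars σ K ^ m) :
    f ∈ idealOfVars σ K ^ m := by
  suffices ∀ k ≤ m, f ∈ idealOfVars σ K ^ k from this m le_rfl
  intro k
  induction k with
  | zero => simp
  | succ k ih =>
    intro hk
    have h₁ : X i * f ∈ idealOfVars σ K ^ (k + 1) := by
      rw [pow_succ']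
      exact Ideal.mul_mem_mul (Ideal.subset_span ⟨i, rfl⟩) (ih (by omega))
    have h₂ := Ideal.sub_mem _ (Ideal.pow_le_pow_right hk h) h₁
    have h₃ := Ideal.mul_mem_left _ (C a⁻¹) h₂
    have h₄ : (C a⁻¹ * C a : MvPolynomial σ K) = 1 := by rw [← C_mul, inv_mul_cancel₀ ha, C_1]
    rwa [show C a⁻¹ * ((X i + C a) * f - X i * f) = f by linear_combination f * h₄] at h₃

lemma mem_idealOfVars_pow_of_aeval {g : σ → MvPolynomial σ K} (hg : ∀ i, g i ∈ idealOfVars σ K)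
    {m : ℕ} {f : MvPolynomial σ K} (h : f ∈ idealOfVars σ K ^ m) :
    aeval g f ∈ idealOfVars σ K ^ m := by
  have h₁ := Ideal.mem_map_of_mem (aeval g : MvPolynomial σ K →ₐ[K] MvPolynomial σ K) h
  rw [Ideal.map_pow] at h₁
  refine Ideal.pow_right_mono ?_ m h₁
  rw [Ideal.map_span, Ideal.span_le]
  rintro _ ⟨_, ⟨i, rfl⟩, rfl⟩
  simpa using hg i

lemma translate_mem_of_mul_mem {i : σ} {u : σ → K} (hu : u i = 0 ∨ u i = 1) {m : ℕ}
    {g : MvPolynomial σ K}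
    (h : translateBy u (X i * ((X i - C 1) * g)) ∈ idealOfVars σ K ^ (m + 1)) :
    translateBy u g ∈ idealOfVars σ K ^ m := by
  simp only [map_mul, translateBy, map_sub, aeval_X, algHom_C, algebraMap_eq] at h
  rcases hu with hu | hu
  · rw [hu, C_0, add_zero] at h
    have h₁ := idealOfVars_pow_of_X_mul_mem h
    rw [sub_eq_add_neg, ← C_neg] at h₁
    exact idealOfVars_pow_of_X_add_C_mul_mem (neg_ne_zero.2 one_ne_zero) h₁
  · rw [hu, add_sub_cancel_right] at h
    exact idealOfVars_pow_of_X_mul_mem (idealOfVars_pow_of_X_add_C_mul_mem one_ne_zero h)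

variable [DecidableEq σ]

lemma translate_restrictTo_mem {S : Finset σ} {c u : σ → K} (hu : ∀ i ∉ S, u i = c i) {m : ℕ}
    {f : MvPolynomial σ K} (h : translateBy u f ∈ idealOfVars σ K ^ m) :
    translateBy u (restrictTo S c f) ∈ idealOfVars σ K ^ m := by
  have key : translateBy u (restrictTo S c f)
      = aeval (fun i => if i ∈ S then X i else 0) (translateBy u f) := by
    rw [← AlgHom.comp_apply, ← AlgHom.comp_apply]
    refine DFunLike.congr_fun (algHom_ext fun i => ?_) f
    by_cases hi : i ∈ S
    · simp [translateBy, restrictTo, hi]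
    · simp [translateBy, restrictTo, hi, hu i hi]
  rw [key]
  refine mem_idealOfVars_pow_of_aeval (fun i => ?_) h
  split_ifs
  · exact Ideal.subset_span ⟨i, rfl⟩
  · exact Ideal.zero_mem _

lemma totalDegree_restrictTo_le (S : Finset σ) (c : σ → K) (f : MvPolynomial σ K) :
    (restrictTo S c f).totalDegree ≤ f.totalDegree := by
  refine totalDegree_aeval_le (fun i => ?_) f
  split_ifs <;> simp

lemma aeval_update_restrictTo_insert (S : Finset σ) {i : σ} (c : σ → K) (a : K) (hi : i ∉ S)
    (f : MvPolynomial σ K) :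
    aeval (Function.update X i (C a)) (restrictTo (insert i S) c f)
      = restrictTo S (Function.update c i a) f := by
  rw [← AlgHom.comp_apply]
  congr 1
  ext1 j
  rcases eq_or_ne j i with rfl | hj
  · simp [restrictTo, hi]
  · by_cases hjS : j ∈ S <;> simp [restrictTo, hj, hjS]

lemma restrictTo_restrictTo (S : Finset σ) (c : σ → K) (f : MvPolynomial σ K) :
    restrictTo S c (restrictTo S c f) = restrictTo S c f := by
  rw [← AlgHom.comp_apply]
  congr 1
  ext1 j
  by_cases hj : j ∈ S <;> simp [restrictTo, hj]

lemma coeff_restrictTo_zero (S : Finset σ) (d : σ →₀ ℕ) (hd : ∀ i ∉ S, d i = 0)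
    (f : MvPolynomial σ K) : coeff d (restrictTo S 0 f) = coeff d f := by
  induction f using MvPolynomial.induction_on' with
  | add p q hp hq => simp [hp, hq]
  | monomial e a =>
    rw [restrictTo, aeval_monomial]
    by_cases he : ∀ i ∉ S, e i = 0
    · congr 1
      rw [monomial_eq]
      congr 1
      refine Finsupp.prod_congr fun i hi => ?_
      rw [if_pos]
      by_contra hiS
      exact (Finsupp.mem_support_iff.1 hi) (he i hiS)
    · push Not at he
      obtain ⟨i, hiS, hi⟩ := he
      rw [Finsupp.prod, Finset.prod_eq_zero (Finsupp.mem_support_iff.2 hi)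
        (by simp [hiS, hi]), mul_zero, coeff_zero, coeff_monomial, if_neg]
      rintro rfl
      exact hi (hd i hiS)

/-- A polynomial of degree less than `2m` which vanishes to order `m` at the vertices of a unit
cube is identically zero on the affine space spanned by the cube. -/
theorem restrictTo_eq_zero_of_vanishing (S : Finset σ) :
    ∀ (c : σ → K) (m : ℕ) (f : MvPolynomial σ K), f.totalDegree < 2 * m →
      (∀ u : σ → K, (∀ i ∈ S, u i = 0 ∨ u i = 1) → (∀ i ∉ S, u i = c i) →
        translateBy u f ∈ idealOfVars σ K ^ m) →
      restrictTo S c f = 0 := by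
  induction S using Finset.induction_on with
  | empty =>
    intro c m f hf h
    have h₁ : restrictTo ∅ c f = C (constantCoeff (translateBy c f)) := by
      have : (restrictTo ∅ c : MvPolynomial σ K →ₐ[K] _).toRingHom
          = C.comp (constantCoeff.comp (translateBy c).toRingHom) := by
        ext <;> simp [restrictTo, translateBy]
      exact congrArg (fun φ => φ f) this
    rw [h₁, constantCoeff_eq,
      (mem_pow_idealOfVars_iff' m _).1 (h c (by simp) (by simp)) 0 (by simp; omega), C_0]
  | insert i S hi ihS =>
    intro c m
    induction m with
    | zero => intro f hf; omega
    | succ m ihm =>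
      intro f hf h
      set F := restrictTo (insert i S) c f with hF
      have hzero : ∀ a : K, a = 0 ∨ a = 1 → aeval (Function.update X i (C a)) F
          = (0 : MvPolynomial σ K) := by
        intro a ha
        rw [hF, aeval_update_restrictTo_insert S c a hi]
        refine ihS _ (m + 1) f hf fun u hu hu' => h u ?_ ?_
        · intro j hj
          rcases Finset.mem_insert.1 hj with rfl | hj
          · simpa [hu' j hi] using ha
          · exact hu j hj
        · intro j hj
          rw [Finset.mem_insert, not_or] at hj
          simpa [hj.1] using hu' j hj.2
      obtain ⟨F₁, hF₁⟩ := X_sub_C_dvd_of_aeval_update_eq_zero (hzero 0 (Or.inl rfl))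
      rw [C_0, sub_zero] at hF₁
      have h₁ : aeval (Function.update X i (C 1)) F₁ = (0 : MvPolynomial σ K) := by
        have := hzero 1 (Or.inr rfl)
        rw [hF₁] at this
        simpa using this
      obtain ⟨g, hg⟩ := X_sub_C_dvd_of_aeval_update_eq_zero h₁
      rw [hg] at hF₁
      rcases eq_or_ne g 0 with rfl | hg0
      · simpa using hF₁
      have hX : coeff (Finsupp.single i 1) (X i - C 1 : MvPolynomial σ K) = 1 := by
        rw [coeff_sub, coeff_X, coeff_C,
          if_neg (Finsupp.single_ne_zero.2 one_ne_zero).symm, sub_zero, if_pos rfl]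
      have hXdeg : 1 ≤ (X i - C 1 : MvPolynomial σ K).totalDegree := by
        simpa using le_totalDegree (mem_support_iff.2 (hX.trans_ne one_ne_zero))
      have hX0 : (X i - C 1 : MvPolynomial σ K) ≠ 0 := fun h0 => by
        rw [h0, coeff_zero] at hX
        exact zero_ne_one hX
      have hdeg : g.totalDegree < 2 * m := by
        have h₂ := (totalDegree_restrictTo_le (insert i S) c f).trans_lt hf
        rw [← hF, hF₁, totalDegree_mul_of_isDomain (X_ne_zero i) (mul_ne_zero hX0 hg0),
          totalDegree_mul_of_isDomain hX0 hg0, totalDegree_X] at h₂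
        omega
      have hg' := ihm g hdeg fun u hu hu' =>
        translate_mem_of_mul_mem (hu i (Finset.mem_insert_self i S))
          (hF₁ ▸ translate_restrictTo_mem hu' (h u hu hu'))
      rw [hF, ← restrictTo_restrictTo, ← hF, hF₁, map_mul, map_mul, hg', mul_zero, mul_zero]

end Cube

/-! ### Taylor coefficients of monomials -/

section Taylor

variable {σ : Type*} [Fintype σ]

/-- The coefficient of `Y ^ γ` in the expansion of `(v + Y) ^ α`. -/
def taylorCoeff {R : Type*} [CommSemiring R] (v : σ → R) (α γ : σ → ℕ) : R :=
  ∏ i, ((α i).choose (γ i) * v i ^ (α i - γ i))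

lemma map_taylorCoeff {R S : Type*} [CommSemiring R] [CommSemiring S] (φ : R →+* S) (v : σ → R)
    (α γ : σ → ℕ) : φ (taylorCoeff v α γ) = taylorCoeff (fun i => φ (v i)) α γ := by
  simp [taylorCoeff]

lemma taylorCoeff_eq_zero {R : Type*} [CommSemiring R] (v : σ → R) {α γ : σ → ℕ} {i : σ}
    (h : α i < γ i) : taylorCoeff v α γ = 0 :=
  Finset.prod_eq_zero (Finset.mem_univ i) (by simp [Nat.choose_eq_zero_of_lt h])

lemma taylorCoeff_smul {R : Type*} [CommSemiring R] (a : R) (v : σ → R) (α γ : σ → ℕ) :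
    taylorCoeff (fun i => a * v i) α γ = a ^ (∑ i, α i - ∑ i, γ i) * taylorCoeff v α γ := by
  by_cases h : ∀ i, γ i ≤ α i
  · rw [← Finset.sum_tsub_distrib _ fun i _ => h i, ← Finset.prod_pow_eq_pow_sum,
      taylorCoeff, taylorCoeff, ← Finset.prod_mul_distrib]
    refine Finset.prod_congr rfl fun i _ => ?_
    rw [mul_pow]
    ring
  · push Not at h
    obtain ⟨i, hi⟩ := h
    rw [taylorCoeff_eq_zero _ hi, taylorCoeff_eq_zero _ hi, mul_zero]

lemma monomial_eq_C_mul_prod {R : Type*} [CommSemiring R] (d : σ →₀ ℕ) (a : R) :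
    monomial d a = C a * ∏ i, X i ^ d i := by
  rw [monomial_eq, Finsupp.prod_fintype _ _ (by simp)]

lemma totalDegree_prod_X_pow_le {R : Type*} [CommSemiring R] [Nontrivial R]
    (γ : σ → ℕ) : (∏ i, (X i : MvPolynomial σ R) ^ γ i).totalDegree ≤ ∑ i, γ i := by
  refine (totalDegree_finsetProd _ _).trans (Finset.sum_le_sum fun i _ => ?_)
  simp

variable [DecidableEq σ]

variable (σ) in
/-- The exponents with all entries at most `t`. -/
def boundedExponents (t : ℕ) : Finset (σ → ℕ) :=
  Fintype.piFinset fun _ => Finset.range (t + 1)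

lemma mem_boundedExponents {t : ℕ} {γ : σ → ℕ} : γ ∈ boundedExponents σ t ↔ ∀ i, γ i ≤ t := by
  simp [boundedExponents]

lemma prod_add_pow_eq_sum_taylorCoeff {R : Type*} [CommSemiring R] (a z : σ → R) {α : σ → ℕ}
    {t : ℕ} (hα : ∀ i, α i ≤ t) :
    ∏ i, (a i + z i) ^ α i
      = ∑ γ ∈ boundedExponents σ t, taylorCoeff a α γ * ∏ i, z i ^ γ i := by
  have h : ∀ i, (a i + z i) ^ α i
      = ∑ j ∈ Finset.range (t + 1), ((α i).choose j * a i ^ (α i - j)) * z i ^ j := by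
    intro i
    rw [add_comm, add_pow, Finset.sum_subset (Finset.range_mono (Nat.succ_le_succ (hα i)))]
    · exact Finset.sum_congr rfl fun j _ => by ring
    · intro j _ hj
      rw [Finset.mem_range, not_lt] at hj
      simp [Nat.choose_eq_zero_of_lt hj]
  simp_rw [h]
  rw [Finset.prod_univ_sum]
  exact Finset.sum_congr rfl fun γ _ => Finset.prod_mul_distrib

lemma coeff_sum_C_mul_prod_X {R : Type*} [CommSemiring R] (Γ : Finset (σ → ℕ))
    (h : (σ → ℕ) → R) (d : σ →₀ ℕ) :
    coeff d (∑ γ ∈ Γ, C (h γ) * ∏ i, (X i : MvPolynomial σ R) ^ γ i)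
      = if ⇑d ∈ Γ then h d else 0 := by
  have key : ∀ γ : σ → ℕ, coeff d (C (h γ) * ∏ i, (X i : MvPolynomial σ R) ^ γ i)
      = if γ = ⇑d then h γ else 0 := by
    intro γ
    have : C (h γ) * ∏ i, (X i : MvPolynomial σ R) ^ γ i
        = monomial (Finsupp.equivFunOnFinite.symm γ) (h γ) := by
      rw [monomial_eq, Finsupp.prod_fintype _ _ (by simp)]
      simp
    rw [this, coeff_monomial]
    congr 1
    rw [Equiv.symm_apply_eq]
    rfl
  rw [coeff_sum]
  simp_rw [key]
  exact Finset.sum_ite_eq' Γ (⇑d) h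

/-- Expansion of a combination of monomials around a point. -/
lemma sum_mul_prod_add_pow {R B κ : Type*} [CommSemiring R] [CommSemiring B] [Fintype κ]
    (φ : R →+* B) (a : σ → R) (z : σ → B) (c : κ → R) {e : κ → σ → ℕ} {t : ℕ}
    (he : ∀ k i, e k i ≤ t) :
    ∑ k, φ (c k) * ∏ i, (φ (a i) + z i) ^ e k i
      = ∑ γ ∈ boundedExponents σ t,
          φ (∑ k, taylorCoeff a (e k) γ * c k) * ∏ i, z i ^ γ i := by
  simp_rw [fun k => prod_add_pow_eq_sum_taylorCoeff (fun i => φ (a i)) z (he k), map_sum,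
    map_mul, map_taylorCoeff, Finset.mul_sum, Finset.sum_mul]
  rw [Finset.sum_comm]
  exact Finset.sum_congr rfl fun γ _ => Finset.sum_congr rfl fun k _ => by ring

variable {K : Type*} [Field K]

/-- If a family of polynomials, parametrized by the affine line with coordinate `s`, vanishes to
order `m` at the points `v + s u` for all vertices `u` of a unit cube, then its member at `s = 0`
vanishes to order `2m` at `v` along the affine space spanned by the cube. -/
theorem sum_taylorCoeff_mul_coeff_zero_eq_zero {κ : Type*} [Fintype κ] {e : κ → σ → ℕ} {t m : ℕ}
    (he : ∀ k i, e k i ≤ t) (S : Finset σ) (v : σ → K) (c : κ → Polynomial K)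
    (hc : ∀ u : σ → K, (∀ i ∈ S, u i = 0 ∨ u i = 1) → (∀ i ∉ S, u i = 0) →
      ∀ γ : σ → ℕ, ∑ i, γ i < m →
        ∑ k, taylorCoeff (fun i => Polynomial.C (v i) + Polynomial.X * Polynomial.C (u i))
          (e k) γ * c k = 0)
    (γ : σ → ℕ) (hγS : ∀ i ∉ S, γ i = 0) (hγ : ∑ i, γ i < 2 * m) :
    ∑ k, taylorCoeff v (e k) γ * (c k).coeff 0 = 0 := by
  let φ : Polynomial K →+* Polynomial (MvPolynomial σ K) := Polynomial.mapRingHom C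
  let Q : Polynomial (MvPolynomial σ K) := ∑ k, φ (c k) *
    ∏ i, (φ (Polynomial.C (v i)) + Polynomial.X * Polynomial.C (X i)) ^ e k i
  let E : (σ → ℕ) → Polynomial K := fun γ =>
    ∑ k, taylorCoeff (fun i => Polynomial.C (v i)) (e k) γ * c k
  have hQ : ∀ r, Q.coeff r = ∑ γ ∈ boundedExponents σ t,
      C (if ∑ i, γ i ≤ r then (E γ).coeff (r - ∑ i, γ i) else 0) * ∏ i, X i ^ γ i := by
    intro r
    simp only [Q]
    rw [sum_mul_prod_add_pow φ _ _ c he, Polynomial.finsetSum_coeff]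
    refine Finset.sum_congr rfl fun γ _ => ?_
    have : φ (E γ) * ∏ i, (Polynomial.X * Polynomial.C (X i : MvPolynomial σ K)) ^ γ i
        = φ (E γ) * Polynomial.C (∏ i, X i ^ γ i) * Polynomial.X ^ (∑ i, γ i) := by
      simp_rw [mul_pow, Finset.prod_mul_distrib, Finset.prod_pow_eq_pow_sum, map_prod, map_pow]
      ring
    change (φ (E γ) * _).coeff r = _
    rw [this, Polynomial.coeff_mul_X_pow']
    split_ifs
    · rw [Polynomial.coeff_mul_C, Polynomial.coe_mapRingHom, Polynomial.coeff_map]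
    · rw [C_0, zero_mul]
  have hdeg : ∀ r, (Q.coeff r).totalDegree ≤ r := by
    intro r
    rw [hQ]
    refine totalDegree_finsetSum_le fun γ _ => ?_
    split_ifs with h
    · refine (totalDegree_mul _ _).trans ?_
      rw [totalDegree_C, zero_add]
      exact (totalDegree_prod_X_pow_le γ).trans h
    · simp
  have hvan : ∀ u : σ → K, (∀ i ∈ S, u i = 0 ∨ u i = 1) → (∀ i ∉ S, u i = 0) →
      ∀ r, translateBy u (Q.coeff r) ∈ idealOfVars σ K ^ m := by
    intro u hu hu' r
    let τ : Polynomial (MvPolynomial σ K) →+* Polynomial (MvPolynomial σ K) :=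
      Polynomial.mapRingHom (translateBy u).toRingHom
    have hτφ : ∀ p, τ (φ p) = φ p := by
      intro p
      have h : (translateBy u).toRingHom.comp C = C :=
        RingHom.ext fun a => algHom_C (translateBy u) a
      simp only [τ, φ, Polynomial.coe_mapRingHom, Polynomial.map_map, h]
    have hfac : ∀ i, τ (φ (Polynomial.C (v i)) + Polynomial.X * Polynomial.C (X i))
        = φ (Polynomial.C (v i) + Polynomial.X * Polynomial.C (u i))
          + Polynomial.X * Polynomial.C (X i) := by
      intro i
      have h₁ : τ Polynomial.X = Polynomial.X := Polynomial.map_X _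
      have h₂ : φ Polynomial.X = Polynomial.X := Polynomial.map_X _
      have h₃ : τ (Polynomial.C (X i)) = Polynomial.C (X i) + φ (Polynomial.C (u i)) := by
        simp [τ, φ, translateBy]
      rw [map_add, map_mul, hτφ, h₁, h₃, map_add, map_mul, h₂]
      ring
    have hτ : τ Q = ∑ k, φ (c k) * ∏ i, (φ (Polynomial.C (v i) + Polynomial.X *
        Polynomial.C (u i)) + Polynomial.X * Polynomial.C (X i)) ^ e k i := by
      simp only [Q, map_sum τ, map_mul τ, map_prod τ, map_pow τ, hτφ, hfac]
    have hmem : τ Q ∈ Ideal.map Polynomial.C (idealOfVars σ K ^ m) := by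
      rw [hτ, sum_mul_prod_add_pow φ _ _ c he]
      refine Ideal.sum_mem _ fun γ _ => ?_
      rcases lt_or_ge (∑ i, γ i) m with h | h
      · rw [hc u hu hu' γ h, map_zero, zero_mul]
        exact Ideal.zero_mem _
      · refine Ideal.mul_mem_left _ _ ?_
        simp_rw [mul_pow, Finset.prod_mul_distrib, ← map_pow, ← map_prod]
        refine Ideal.mul_mem_left _ _ (Ideal.mem_map_of_mem _ (Ideal.pow_le_pow_right h ?_))
        rw [← Finset.prod_pow_eq_pow_sum]
        exact Ideal.prod_mem_prod fun i _ => Ideal.pow_mem_pow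
          (Ideal.subset_span (Set.mem_range_self i)) _
    have := Ideal.mem_map_C_iff.1 hmem r
    simpa [τ, Polynomial.coeff_map] using this
  have hzero := restrictTo_eq_zero_of_vanishing S 0 m (Q.coeff (∑ i, γ i))
    ((hdeg _).trans_lt hγ) fun u hu hu' => hvan u hu hu' _
  have hcoeff := coeff_restrictTo_zero S (Finsupp.equivFunOnFinite.symm γ) hγS
    (Q.coeff (∑ i, γ i))
  rw [hzero, coeff_zero, hQ, coeff_sum_C_mul_prod_X] at hcoeff
  change 0 = if γ ∈ boundedExponents σ t then
    if ∑ i, γ i ≤ ∑ i, γ i then (E γ).coeff (∑ i, γ i - ∑ i, γ i) else 0 else 0 at hcoeff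
  by_cases hmem : γ ∈ boundedExponents σ t
  · rw [if_pos hmem, if_pos le_rfl, Nat.sub_self] at hcoeff
    rw [hcoeff]
    simp only [E, Polynomial.coeff_zero_eq_eval_zero, Polynomial.eval_finsetSum,
      Polynomial.eval_mul]
    refine Finset.sum_congr rfl fun k _ => ?_
    congr 1
    rw [← Polynomial.coe_evalRingHom, map_taylorCoeff]
    simp
  · rw [mem_boundedExponents] at hmem
    push Not at hmem
    obtain ⟨i, hi⟩ := hmem
    exact Finset.sum_eq_zero fun k _ => by
      rw [taylorCoeff_eq_zero v ((he k i).trans_lt hi), zero_mul]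

end Taylor

/-! ### Powers of point ideals in terms of Taylor coefficients -/

section PointIdeal

/-- The exponents of the monomials of degree `t` in four variables. -/
abbrev FormExponent (t : ℕ) : Type :=
  (Finset.finsuppAntidiag (Finset.univ : Finset (Fin 4)) t : Finset (Fin 4 →₀ ℕ))

lemma FormExponent.sum_eq {t : ℕ} (k : FormExponent t) : ∑ i, k.1 i = t :=
  (Finset.mem_finsuppAntidiag.1 k.2).1

lemma FormExponent.le {t : ℕ} (k : FormExponent t) (i : Fin 4) : k.1 i ≤ t :=
  (Finset.single_le_sum (fun _ _ => Nat.zero_le _) (Finset.mem_univ i)).trans_eq k.sum_eq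

variable {K : Type} [Field K]

lemma isHomogeneous_sum_monomial {t : ℕ} (c : FormExponent t → K) :
    (∑ k, monomial k.1 (c k)).IsHomogeneous t :=
  IsHomogeneous.sum _ _ _ fun k _ => isHomogeneous_monomial _ <| by
    rw [Finsupp.degree_eq_sum, k.sum_eq]

lemma coeff_sum_monomial {t : ℕ} (c : FormExponent t → K) (k : FormExponent t) :
    coeff k.1 (∑ l, monomial l.1 (c l)) = c k := by
  simp [coeff_sum, coeff_monomial]

lemma sum_monomial_coeff_eq {t : ℕ} {f : MvPolynomial (Fin 4) K} (hf : f.IsHomogeneous t) :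
    ∑ k : FormExponent t, monomial k.1 (coeff k.1 f) = f := by
  rw [Finset.sum_coe_sort (Finset.finsuppAntidiag Finset.univ t) fun d => monomial d (coeff d f)]
  conv_rhs => rw [f.as_sum]
  refine (Finset.sum_subset (fun d hd => ?_) fun d _ hd => ?_).symm
  · rw [Finset.mem_finsuppAntidiag]
    refine ⟨?_, Finset.subset_univ _⟩
    rw [← Finsupp.degree_eq_sum]
    by_contra h
    exact mem_support_iff.1 hd (hf.coeff_eq_zero h)
  · rw [notMem_support_iff.1 hd, monomial_zero]

lemma translateBy_mem_of_mem_pointIdeal_pow {w : Fin 4 → K} {m : ℕ} {f : MvPolynomial (Fin 4) K}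
    (hf : f ∈ pointIdeal K w ^ m) : translateBy w f ∈ idealOfVars (Fin 4) K ^ m := by
  have h₁ := Ideal.mem_map_of_mem (translateBy w) hf
  rw [Ideal.map_pow] at h₁
  refine Ideal.pow_right_mono ?_ m h₁
  rw [pointIdeal, Ideal.map_span, Ideal.span_le]
  rintro _ ⟨f, ⟨-, hf⟩, rfl⟩
  have h₂ : constantCoeff (translateBy w f) = eval w f := by
    have : constantCoeff.comp (translateBy w).toRingHom = eval w := by
      ext <;> simp [translateBy]
    exact congrArg (fun φ => φ f) this
  rw [SetLike.mem_coe, ← pow_one (idealOfVars (Fin 4) K), mem_pow_idealOfVars_iff']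
  intro d hd
  rw [Nat.lt_one_iff, Finsupp.degree_eq_zero_iff] at hd
  rw [hd, ← constantCoeff_eq, h₂, hf]

lemma sum_taylorCoeff_eq_zero_of_mem {t m : ℕ} {w : Fin 4 → K} {c : FormExponent t → K}
    (hc : ∑ k, monomial k.1 (c k) ∈ pointIdeal K w ^ m) (γ : Fin 4 → ℕ) (hγ : ∑ i, γ i < m) :
    ∑ k, taylorCoeff w k.1 γ * c k = 0 := by
  have h₁ : translateBy w (∑ k, monomial k.1 (c k))
      = ∑ k, C (c k) * ∏ i, (C (w i) + X i) ^ (k.1 i) := by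
    simp [translateBy, monomial_eq_C_mul_prod, add_comm]
  have h₂ := (mem_pow_idealOfVars_iff' m _).1 (translateBy_mem_of_mem_pointIdeal_pow hc)
    (Finsupp.equivFunOnFinite.symm γ) (by rwa [Finsupp.degree_eq_sum])
  rw [h₁, sum_mul_prod_add_pow C w X c (e := fun k => k.1) FormExponent.le,
    coeff_sum_C_mul_prod_X] at h₂
  by_cases hmem : γ ∈ boundedExponents (Fin 4) t
  · rwa [if_pos (by simpa using hmem)] at h₂
  · rw [mem_boundedExponents] at hmem
    push Not at hmem
    obtain ⟨i, hi⟩ := hmem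
    exact Finset.sum_eq_zero fun k _ => by
      rw [taylorCoeff_eq_zero w ((k.le i).trans_lt hi), zero_mul]

lemma sum_monomial_mem_pointIdeal_pow {t n : ℕ} {v : Fin 4 → K} (hv : v 0 ≠ 0)
    {c : FormExponent t → K}
    (hc : ∀ γ : Fin 4 → ℕ, γ 0 = 0 → ∑ i, γ i < n → ∑ k, taylorCoeff v k.1 γ * c k = 0) :
    ∑ k, monomial k.1 (c k) ∈ pointIdeal K v ^ n := by
  let l : MvPolynomial (Fin 4) K := C (v 0)⁻¹ * X 0
  let y : Fin 4 → MvPolynomial (Fin 4) K := fun i => X i - l * C (v i)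
  have hy : ∀ i, y i ∈ pointIdeal K v := by
    intro i
    refine Ideal.subset_span ⟨?_, by simp [y, l, hv]⟩
    have hl : l.IsHomogeneous 1 := isHomogeneous_C_mul_X _ _
    refine (isHomogeneous_X _ _).sub ?_
    simpa using hl.mul (isHomogeneous_C (Fin 4) (v i))
  have hy0 : y 0 = 0 := by
    have : (C (v 0)⁻¹ * C (v 0) : MvPolynomial (Fin 4) K) = 1 := by
      rw [← C_mul, inv_mul_cancel₀ hv, C_1]
    linear_combination (-X 0) * this
  have h₁ : ∑ k, monomial k.1 (c k)
      = ∑ k, RingHom.id _ (C (c k)) * ∏ i, (RingHom.id _ (l * C (v i)) + y i) ^ (k.1 i) := by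
    simp [y, monomial_eq_C_mul_prod]
  rw [h₁, sum_mul_prod_add_pow (RingHom.id _) (fun i => l * C (v i)) y (fun k => C (c k))
    (e := fun k => k.1) FormExponent.le]
  refine Ideal.sum_mem _ fun γ _ => ?_
  rcases le_or_gt n (∑ i, γ i) with h | h
  · refine Ideal.mul_mem_left _ _ (Ideal.pow_le_pow_right h ?_)
    rw [← Finset.prod_pow_eq_pow_sum]
    exact Ideal.prod_mem_prod fun i _ => Ideal.pow_mem_pow (hy i) _
  · by_cases h0 : γ 0 = 0
    · have h₂ : ∑ k, taylorCoeff (fun i => l * C (v i)) k.1 γ * C (c k)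
          = l ^ (t - ∑ i, γ i) * C (∑ k, taylorCoeff v k.1 γ * c k) := by
        rw [map_sum, Finset.mul_sum]
        refine Finset.sum_congr rfl fun k _ => ?_
        rw [taylorCoeff_smul, k.sum_eq, C_mul, map_taylorCoeff, mul_assoc]
      rw [h₂, hc γ h0 h]
      simp
    · rw [Finset.prod_eq_zero (Finset.mem_univ 0) (by rw [hy0, zero_pow h0]), mul_zero]
      exact Ideal.zero_mem _

end PointIdeal

/-! ### Linear systems with polynomial coefficients -/

section LinearSystem

open Matrix

lemma exists_mul_eq_one_of_mulVec_injective {L ρ κ : Type*} [Field L] [Fintype ρ] [Fintype κ]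
    [DecidableEq κ] {M : Matrix ρ κ L} (hM : ∀ c, M *ᵥ c = 0 → c = 0) :
    ∃ N : Matrix κ ρ L, N * M = 1 := by
  classical
  obtain ⟨g, hg⟩ := M.mulVecLin.exists_leftInverse_of_injective
    (LinearMap.ker_eq_bot'.2 fun c hc => hM c hc)
  refine ⟨LinearMap.toMatrix' g, ?_⟩
  have := congrArg LinearMap.toMatrix' hg
  rwa [LinearMap.toMatrix'_comp, ← Matrix.toLin'_apply', LinearMap.toMatrix'_toLin',
    LinearMap.toMatrix'_id] at this

lemma exists_mul_eq_smul_one_of_mulVec_injective {A ρ κ : Type*} [CommRing A] [IsDomain A]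
    [Fintype ρ] [Fintype κ] [DecidableEq κ] {M : Matrix ρ κ A}
    (hM : ∀ c, M *ᵥ c = 0 → c = 0) :
    ∃ (N : Matrix κ ρ A) (d : A), d ≠ 0 ∧ N * M = d • 1 := by
  let φ := algebraMap A (FractionRing A)
  have hφ : Function.Injective φ := IsFractionRing.injective A (FractionRing A)
  have hM' : ∀ c, M.map φ *ᵥ c = 0 → c = 0 := by
    intro c hc
    obtain ⟨b, hb⟩ := IsLocalization.exist_integer_multiples_of_finite (nonZeroDivisors A) c
    choose c' hc' using hb
    have hb0 : φ b ≠ 0 := fun h => nonZeroDivisors.ne_zero b.2 (hφ (h.trans (map_zero φ).symm))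
    have hcc : φ ∘ c' = φ b • c := by
      ext i
      simp only [Function.comp_apply, Pi.smul_apply, smul_eq_mul]
      rw [show φ (c' i) = _ from hc' i, Algebra.smul_def]
    have h₁ : M *ᵥ c' = 0 := by
      ext i
      apply hφ
      rw [RingHom.map_mulVec, hcc, mulVec_smul, hc]
      simp
    rw [hM c' h₁] at hcc
    have h₂ : φ b • c = 0 := by
      rw [← hcc]
      ext
      simp
    exact (smul_eq_zero.1 h₂).resolve_left hb0
  obtain ⟨N, hN⟩ := exists_mul_eq_one_of_mulVec_injective hM'
  obtain ⟨b, hb⟩ := IsLocalization.exist_integer_multiples_of_finite (nonZeroDivisors A)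
    fun p : κ × ρ => N p.1 p.2
  choose N' hN' using hb
  refine ⟨Matrix.of fun i j => N' (i, j), b, nonZeroDivisors.ne_zero b.2, ?_⟩
  apply Matrix.map_injective hφ
  have h₁ : (Matrix.of fun i j => N' (i, j)).map φ = φ b • N := by
    ext i j
    simp only [map_apply, of_apply, Matrix.smul_apply, smul_eq_mul]
    rw [show φ (N' (i, j)) = _ from hN' (i, j), Algebra.smul_def]
  change ((Matrix.of fun i j => N' (i, j)) * M).map φ = ((b : A) • (1 : Matrix κ κ A)).map φ
  rw [Matrix.map_mul, h₁, Matrix.smul_mul, hN]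
  ext i j
  simp [Matrix.one_apply, apply_ite φ]

lemma exists_eval_mulVec_injective {K ρ κ : Type*} [Field K] [Infinite K] [Fintype ρ] [Fintype κ]
    {M : Matrix ρ κ (Polynomial K)} (hM : ∀ c, M *ᵥ c = 0 → c = 0) :
    ∃ s : K, ∀ c, M.map (Polynomial.evalRingHom s) *ᵥ c = 0 → c = 0 := by
  classical
  obtain ⟨N, d, hd, hNM⟩ := exists_mul_eq_smul_one_of_mulVec_injective hM
  obtain ⟨s, hs⟩ : ∃ s, d.eval s ≠ 0 := by
    by_contra! h
    exact hd (Polynomial.funext (by simpa using h))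
  refine ⟨s, fun c hc => ?_⟩
  have h₁ := congrArg (fun P => P.map (Polynomial.evalRingHom s)) hNM
  simp only [Matrix.map_mul] at h₁
  have h₂ : (d • (1 : Matrix κ κ (Polynomial K))).map (Polynomial.evalRingHom s)
      = d.eval s • 1 := by
    ext i j
    simp [Matrix.one_apply, apply_ite (Polynomial.eval s)]
  rw [h₂] at h₁
  have h₃ := congrArg (fun P => P *ᵥ c) h₁
  simp only [← mulVec_mulVec, hc, mulVec_zero, smul_mulVec, one_mulVec] at h₃
  exact (smul_eq_zero.1 h₃.symm).resolve_left hs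

lemma eq_zero_of_mulVec_eq_zero_of_coeff_zero {K ρ κ : Type*} [Field K] [Fintype κ]
    {M : Matrix ρ κ (Polynomial K)}
    (hM : ∀ c, M *ᵥ c = 0 → ∀ k, (c k).coeff 0 = 0) (c : κ → Polynomial K)
    (hc : M *ᵥ c = 0) : c = 0 := by
  have key : ∀ n : ℕ, ∀ c, M *ᵥ c = 0 → ∀ k, Polynomial.X ^ n ∣ c k := by
    intro n
    induction n with
    | zero => simp
    | succ n ih =>
      intro c hc
      have h₁ := fun k => Polynomial.X_dvd_iff.2 (hM c hc k)
      choose c' hc' using h₁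
      have h₂ : c = (Polynomial.X : Polynomial K) • c' := funext hc'
      rw [h₂, mulVec_smul] at hc
      have h₃ := (smul_eq_zero.1 hc).resolve_left Polynomial.X_ne_zero
      intro k
      rw [hc' k, pow_succ']
      exact mul_dvd_mul_left _ (ih c' h₃ k)
  ext k n
  rw [Polynomial.X_pow_dvd_iff.1 (key (n + 1) c hc k) n n.lt_succ_self]
  simp

end LinearSystem

/-! ### The gluing theorem -/

section Glue

open Matrix

/-- The matrix of the conditions imposed on forms of degree `t` by vanishing to order `m` at the
points `w j`. -/
def vanishingMatrix {R ι : Type*} [CommRing R] (t m : ℕ) (w : ι → Fin 4 → R) :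
    Matrix (ι × (Fin 4 → Fin m)) (FormExponent t) R :=
  Matrix.of fun p k => if ∑ i, (p.2 i : ℕ) < m then taylorCoeff (w p.1) k.1 (fun i => p.2 i) else 0

lemma vanishingMatrix_mulVec_eq_zero_iff {R ι : Type*} [CommRing R] {t m : ℕ}
    {w : ι → Fin 4 → R} {c : FormExponent t → R} :
    vanishingMatrix t m w *ᵥ c = 0 ↔
      ∀ j, ∀ γ : Fin 4 → ℕ, ∑ i, γ i < m → ∑ k, taylorCoeff (w j) k.1 γ * c k = 0 := by
  constructor
  · intro h j γ hγ
    have hlt : ∀ i, γ i < m := fun i =>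
      (Finset.single_le_sum (fun _ _ => Nat.zero_le _) (Finset.mem_univ i)).trans_lt hγ
    simpa [vanishingMatrix, mulVec, dotProduct, hγ] using
      congrFun h (j, fun i => ⟨γ i, hlt i⟩)
  · intro h
    ext ⟨j, γ⟩
    by_cases hγ : ∑ i, (γ i : ℕ) < m
    · simpa [vanishingMatrix, mulVec, dotProduct, hγ] using h j (fun i => γ i) hγ
    · simp [vanishingMatrix, mulVec, dotProduct, hγ]

lemma map_vanishingMatrix {R S ι : Type*} [CommRing R] [CommRing S] (φ : R →+* S) (t m : ℕ)
    (w : ι → Fin 4 → R) :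
    (vanishingMatrix t m w).map φ = vanishingMatrix t m fun j i => φ (w j i) := by
  ext p k
  simp only [vanishingMatrix, map_apply, of_apply, apply_ite φ, map_zero, map_taylorCoeff]

/-- If the conditions of vanishing to order `m` at some tuple of points force a form of degree `t`
to be zero, then so do the conditions at a general tuple of points. -/
lemma exists_polynomial_of_vanishingMatrix_injective {K : Type} [Field K] {ι : Type*} [Fintype ι]
    {t m : ℕ} {w₀ : ι → Fin 4 → K}
    (hw₀ : ∀ c, vanishingMatrix t m w₀ *ᵥ c = 0 → c = 0) :
    ∃ H : MvPolynomial (ι × Fin 4) K, H ≠ 0 ∧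
      ∀ w : ι → Fin 4 → K, eval (fun p => w p.1 p.2) H ≠ 0 →
        ∀ f ∈ ⨅ j, pointIdeal K (w j) ^ m, f.IsHomogeneous t → f = 0 := by
  classical
  obtain ⟨N, hN⟩ := exists_mul_eq_one_of_mulVec_injective hw₀
  let P : Matrix (FormExponent t) (ι × (Fin 4 → Fin m)) (MvPolynomial (ι × Fin 4) K) := N.map C
  let V := vanishingMatrix t m fun (j : ι) i => (X (j, i) : MvPolynomial (ι × Fin 4) K)
  have hH : ∀ w : ι → Fin 4 → K,
      eval (fun p => w p.1 p.2) (P * V).det = (N * vanishingMatrix t m w).det := by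
    intro w
    rw [RingHom.map_det, RingHom.mapMatrix_apply, Matrix.map_mul, map_vanishingMatrix]
    congr 2
    · ext
      simp [P]
    · simp
  refine ⟨(P * V).det, fun h => ?_, fun w hw f hf hft => ?_⟩
  · have := hH w₀
    rw [h, hN, det_one, map_zero] at this
    exact zero_ne_one this
  · rw [hH] at hw
    have hc : vanishingMatrix t m w *ᵥ (fun k => coeff k.1 f) = 0 := by
      refine vanishingMatrix_mulVec_eq_zero_iff.2 fun j γ hγ =>
        sum_taylorCoeff_eq_zero_of_mem ?_ γ hγ
      rw [sum_monomial_coeff_eq hft]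
      exact (Ideal.mem_iInf.1 hf) j
    have hc0 := eq_zero_of_mulVec_eq_zero hw (v := fun k => coeff k.1 f) (by
      rw [← mulVec_mulVec, hc, mulVec_zero])
    rw [← sum_monomial_coeff_eq hft]
    exact Finset.sum_eq_zero fun k _ => by rw [congrFun hc0 k, Pi.zero_apply, monomial_zero]

/-- The vertices of the unit cube in the hyperplane where the zeroth coordinate vanishes. -/
def cubeVertex (K : Type) [Field K] (a : Fin 8) : Fin 4 → K :=
  Fin.cons 0 fun i => ((finFunctionFinEquiv (m := 2) (n := 3)).symm a i : ℕ)

lemma exists_cubeVertex_eq {K : Type} [Field K] {u : Fin 4 → K} (h0 : u 0 = 0)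
    (h : ∀ i ≠ 0, u i = 0 ∨ u i = 1) : ∃ a, cubeVertex K a = u := by
  classical
  refine ⟨finFunctionFinEquiv (m := 2) (n := 3) fun i => if u i.succ = 0 then 0 else 1, ?_⟩
  ext i
  refine Fin.cases ?_ (fun i => ?_) i
  · simp [cubeVertex, h0]
  · rw [cubeVertex, Fin.cons_succ, Equiv.symm_apply_apply]
    rcases h i.succ (Fin.succ_ne_zero i) with h | h <;> simp [h]

/-- The degeneration step: a form whose deformation vanishes to order `m` at the eight points
`v + X u`, with `u` a vertex of the unit cube, itself vanishes to order `2 * m` at `v`. -/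
lemma sum_monomial_mem_pointIdeal_pow_of_cubeVertex {K : Type} [Field K] {t m : ℕ}
    {v : Fin 4 → K} (hv : v 0 ≠ 0) {c : FormExponent t → Polynomial K}
    (hc : ∀ a, ∀ γ : Fin 4 → ℕ, ∑ i, γ i < m → ∑ k, taylorCoeff (fun i =>
      Polynomial.C (v i) + Polynomial.X * Polynomial.C (cubeVertex K a i)) k.1 γ * c k = 0) :
    ∑ k, monomial k.1 ((c k).coeff 0) ∈ pointIdeal K v ^ (2 * m) := by
  refine sum_monomial_mem_pointIdeal_pow hv fun γ hγ0 hγ => ?_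
  refine sum_taylorCoeff_mul_coeff_zero_eq_zero (e := fun (k : FormExponent t) i => k.1 i)
    FormExponent.le ({0}ᶜ : Finset (Fin 4)) v c (fun u hu hu' δ hδ => ?_) γ ?_ hγ
  · obtain ⟨a, rfl⟩ := exists_cubeVertex_eq (hu' 0 (by simp)) (fun i hi => hu i (by simpa using hi))
    exact hc a δ hδ
  · intro i hi
    have : i = 0 := by simpa using hi
    rw [this, hγ0]

/-- Gluing: if the fat points ideal of `b` general points with multiplicity `2m` has no
nonzero form of degree `t`, then the fat points ideal of `8b` general points with
multiplicity `m` has no nonzero form of degree `t`. -/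
theorem glue_eight_points (K : Type) [Field K] [CharZero K] (b m t : ℕ)
    (hb : 1 ≤ b) (hm : 1 ≤ m)
    (hG : ∃ G : MvPolynomial (Fin b × Fin 4) K, G ≠ 0 ∧
      ∀ v : Fin b → Fin 4 → K, (∀ j, v j ≠ 0) →
        eval (fun p => v p.1 p.2) G ≠ 0 →
        ∀ f ∈ ⨅ j, pointIdeal K (v j) ^ (2 * m), f.IsHomogeneous t → f = 0) :
    ∃ H : MvPolynomial (Fin (8 * b) × Fin 4) K, H ≠ 0 ∧
      ∀ w : Fin (8 * b) → Fin 4 → K, (∀ j, w j ≠ 0) →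
        eval (fun p => w p.1 p.2) H ≠ 0 →
        ∀ f ∈ ⨅ j, pointIdeal K (w j) ^ m, f.IsHomogeneous t → f = 0 := by
  obtain ⟨G, hG0, hG⟩ := hG
  obtain ⟨x, hx⟩ : ∃ x, eval x (G * ∏ j, X (j, 0)) ≠ 0 := by
    by_contra! h
    exact mul_ne_zero hG0 (Finset.prod_ne_zero_iff.2 fun j _ => X_ne_zero _)
      (MvPolynomial.funext (by simpa using h))
  rw [map_mul, map_prod, mul_ne_zero_iff, Finset.prod_ne_zero_iff] at hx
  have hv0 : ∀ j, x (j, 0) ≠ 0 := fun j => by simpa using hx.2 j (Finset.mem_univ j)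
  have hv := hG (fun j i => x (j, i)) (fun j h => hv0 j (congrFun h 0)) hx.1
  let W : Fin (8 * b) → Fin 4 → Polynomial K := fun j i =>
    Polynomial.C (x ((finProdFinEquiv.symm j).2, i))
      + Polynomial.X * Polynomial.C (cubeVertex K (finProdFinEquiv.symm j).1 i)
  have hW : ∀ c, vanishingMatrix t m W *ᵥ c = 0 → c = 0 := by
    refine eq_zero_of_mulVec_eq_zero_of_coeff_zero fun c hc k => ?_
    rw [vanishingMatrix_mulVec_eq_zero_iff] at hc
    have hmem : ∑ k, monomial k.1 ((c k).coeff 0)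
        ∈ ⨅ j, pointIdeal K (fun i => x (j, i)) ^ (2 * m) :=
      Ideal.mem_iInf.2 fun j =>
        sum_monomial_mem_pointIdeal_pow_of_cubeVertex (v := fun i => x (j, i)) (hv0 j)
          fun a δ hδ => by
            have h := hc (finProdFinEquiv (a, j)) δ hδ
            simp only [W, Equiv.symm_apply_apply] at h
            exact h
    rw [← coeff_sum_monomial (fun k => (c k).coeff 0) k,
      hv _ hmem (isHomogeneous_sum_monomial fun k => (c k).coeff 0), coeff_zero]
  obtain ⟨s, hs⟩ := exists_eval_mulVec_injective hW
  rw [map_vanishingMatrix] at hs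
  obtain ⟨H, hH0, hH⟩ := exists_polynomial_of_vanishingMatrix_injective hs
  exact ⟨H, hH0, fun w _ => hH w⟩

end Glue

end
end
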